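/- Under the standing hypotheses, no two distinct cycles of G, each of length at most g+1, are spliced; that is, there do not exist cycles C and D of G with different edge sets, each of length at most g+1, together with vertices a, b, c such that both edges ab and bc belong to both C and D. -/

import Mathlib

open SimpleGraph

/-- Two graphs have the same `k`-deck if there is a bijection between their `k`-element
vertex subsets under which corresponding induced subgraphs are isomorphic. -/
def SameDeck {V W : Type*} [Fintype V] [Fintype W] [DecidableEq V] [DecidableEq W]
    (G : SimpleGraph V) (H : SimpleGraph W) (k : ℕ) : Prop :=
  ∃ e : {s : Finset V // s.card = k} ≃ {s : Finset W // s.card = k},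
    ∀ s : {s : Finset V // s.card = k},
      Nonempty ((G.induce (↑s.1 : Set V)) ≃g (H.induce (↑(e s).1 : Set W)))

/-! ### Bounded walks avoiding a set -/

section Link

variable {V : Type*} {G H : SimpleGraph V} {S T : Set V} {n m i j : ℕ} {u v w x z : V}

/-- `Link G S n u v` means that some walk from `u` to `v` of length at most `n` avoids `S`. -/
def Link (G : SimpleGraph V) (S : Set V) (n : ℕ) (u v : V) : Prop :=
  ∃ p : G.Walk u v, p.length ≤ n ∧ ∀ z ∈ p.support, z ∉ S

theorem Link.mono (h : Link G S n u v) (hT : T ⊆ S) (hn : n ≤ m) : Link G T m u v := by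
  obtain ⟨p, hp, hS⟩ := h
  exact ⟨p, hp.trans hn, fun z hz hzT => hS z hz (hT hzT)⟩

theorem Link.symm (h : Link G S n u v) : Link G S n v u := by
  obtain ⟨p, hp, hS⟩ := h
  exact ⟨p.reverse, by simpa using hp, by simpa using hS⟩

theorem Link.left_notMem (h : Link G S n u v) : u ∉ S := by
  obtain ⟨p, -, hS⟩ := h
  exact hS u p.start_mem_support

theorem Link.right_notMem (h : Link G S n u v) : v ∉ S := h.symm.left_notMem

theorem Link.refl (hu : u ∉ S) : Link G S n u u :=
  ⟨Walk.nil, by simp, by simpa using hu⟩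

theorem Link.cons (h : Link G S n v w) (huv : G.Adj u v) (hu : u ∉ S) :
    Link G S (n + 1) u w := by
  obtain ⟨p, hp, hS⟩ := h
  refine ⟨Walk.cons huv p, by simpa using hp, ?_⟩
  simpa using ⟨hu, hS⟩

theorem Link.snoc (h : Link G S n u v) (hvw : G.Adj v w) (hw : w ∉ S) :
    Link G S (n + 1) u w :=
  (h.symm.cons hvw.symm hw).symm

theorem Link.transfer (h : Link G S n u v)
    (hGH : ∀ a b, a ∉ S → b ∉ S → G.Adj a b → H.Adj a b) : Link H S n u v := by
  obtain ⟨p, hp, hS⟩ := h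
  have hpH : ∀ e ∈ p.edges, e ∈ H.edgeSet := by
    intro e he
    induction e with
    | _ a b =>
      exact hGH a b (hS a (p.fst_mem_support_of_mem_edges he))
        (hS b (p.snd_mem_support_of_mem_edges he)) (p.adj_of_mem_edges he)
  exact ⟨p.transfer H hpH, by simpa using hp, by simpa using hS⟩

/-- A link contains a path. -/
theorem Link.exists_isPath (h : Link G S n u v) :
    ∃ p : G.Walk u v, p.IsPath ∧ p.length ≤ n ∧ ∀ z ∈ p.support, z ∉ S := by
  classical
  obtain ⟨p, hp, hS⟩ := h
  exact ⟨p.bypass, p.bypass_isPath, p.length_bypass_le_length.trans hp,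
    fun z hz => hS z (p.support_bypass_subset_support hz)⟩

theorem Link.step (h : Link G S n u v) (huv : u ≠ v) :
    ∃ m u', n = m + 1 ∧ G.Adj u u' ∧ Link G (insert u S) m u' v := by
  obtain ⟨p, hp, hn, hS⟩ := h.exists_isPath
  cases p with
  | nil => exact absurd rfl huv
  | @cons _ u' _ huu q =>
    rw [Walk.cons_isPath_iff] at hp
    simp only [Walk.length_cons] at hn
    obtain ⟨m, rfl⟩ : ∃ m, n = m + 1 := ⟨n - 1, by omega⟩
    refine ⟨m, u', rfl, huu, q, by omega, fun z hz => ?_⟩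
    rintro (rfl | hz')
    · exact hp.2 hz
    · exact hS z (by simp [hz]) hz'

theorem Link.split (h : Link G S n u v) (z : V) :
    Link G (insert z S) n u v ∨ ∃ i j, i + j ≤ n ∧ Link G S i u z ∧ Link G S j z v := by
  classical
  obtain ⟨p, hn, hS⟩ := h
  by_cases hz : z ∈ p.support
  · right
    refine ⟨(p.takeUntil z hz).length, (p.dropUntil z hz).length, ?_, ⟨_, le_rfl, fun a ha => ?_⟩,
      ⟨_, le_rfl, fun a ha => ?_⟩⟩
    · rw [← Walk.length_append, Walk.take_spec]; exact hn
    · exact hS a (p.support_takeUntil_subset_support hz ha)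
    · exact hS a (p.support_dropUntil_subset_support hz ha)
  · left
    refine ⟨p, hn, fun a ha => ?_⟩
    rintro (rfl | h)
    exacts [hz ha, hS a ha h]

/-- Every cycle of `G` has length at least `m`. -/
def GirthGE (G : SimpleGraph V) (m : ℕ) : Prop :=
  ∀ (u : V) (c : G.Walk u u), c.IsCycle → m ≤ c.length

/-- A path between two neighbours of a vertex it avoids closes up to a cycle. -/
theorem SimpleGraph.Walk.IsPath.isCycle_cons_concat {p : G.Walk u v} (hp : p.IsPath)
    (hxu : G.Adj x u) (hvx : G.Adj v x) (huv : u ≠ v) (hx : x ∉ p.support) :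
    (Walk.cons hxu (p.concat hvx)).IsCycle := by
  rw [Walk.cons_isCycle_iff]
  refine ⟨hp.concat hx hvx, fun he => ?_⟩
  rw [Walk.edges_concat, List.concat_eq_append, List.mem_append, List.mem_singleton] at he
  rcases he with he | he
  · exact hx (p.fst_mem_support_of_mem_edges he)
  · have := hxu.ne
    grind [Sym2.eq_iff]

theorem GirthGE.le_of_link (hg : GirthGE G m) (hxu : G.Adj x u) (hxv : G.Adj x v) (huv : u ≠ v)
    (h : Link G S n u v) (hx : x ∈ S) : m ≤ n + 2 := by
  obtain ⟨p, hp, hn, hS⟩ := h.exists_isPath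
  have := hg _ _ (hp.isCycle_cons_concat hxu hxv.symm huv fun hx' => hS x hx' hx)
  simp only [Walk.length_cons, Walk.length_concat] at this
  omega

end Link

/-! ### Five consecutive vertices of a short closed walk -/

section Arc

variable {V : Type*} {G H : SimpleGraph V} {n k : ℕ} {v₀ v₁ v₂ v₃ v₄ z : V}

/-- `Arc G n v₀ v₁ v₂ v₃ v₄` means that `v₀ v₁ v₂ v₃ v₄` are consecutive vertices of a closed walk
of length at most `n + 4` which does not return to `v₁`, `v₂`, `v₃`. -/
structure Arc (G : SimpleGraph V) (n : ℕ) (v₀ v₁ v₂ v₃ v₄ : V) : Prop where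
  adj₀₁ : G.Adj v₀ v₁
  adj₁₂ : G.Adj v₁ v₂
  adj₂₃ : G.Adj v₂ v₃
  adj₃₄ : G.Adj v₃ v₄
  ne₁₃ : v₁ ≠ v₃
  link : Link G {v₁, v₂, v₃} n v₀ v₄

theorem Arc.symm (h : Arc G n v₀ v₁ v₂ v₃ v₄) : Arc G n v₄ v₃ v₂ v₁ v₀ :=
  ⟨h.adj₃₄.symm, h.adj₂₃.symm, h.adj₁₂.symm, h.adj₀₁.symm, h.ne₁₃.symm,
    h.link.symm.mono (by intro; simp; tauto) le_rfl⟩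

theorem Arc.mono (h : Arc G n v₀ v₁ v₂ v₃ v₄) {m : ℕ} (hnm : n ≤ m) : Arc G m v₀ v₁ v₂ v₃ v₄ :=
  ⟨h.1, h.2, h.3, h.4, h.5, h.6.mono subset_rfl hnm⟩

theorem Arc.ne₀₂ (h : Arc G n v₀ v₁ v₂ v₃ v₄) : v₀ ≠ v₂ := by
  rintro rfl; exact h.link.left_notMem (by simp)

theorem Arc.ne₀₃ (h : Arc G n v₀ v₁ v₂ v₃ v₄) : v₀ ≠ v₃ := by
  rintro rfl; exact h.link.left_notMem (by simp)

theorem Arc.ne₂₄ (h : Arc G n v₀ v₁ v₂ v₃ v₄) : v₂ ≠ v₄ := h.symm.ne₀₂.symm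

theorem Arc.ne₁₄ (h : Arc G n v₀ v₁ v₂ v₃ v₄) : v₁ ≠ v₄ := h.symm.ne₀₃.symm

theorem GirthGE.ne_of_path (hg : GirthGE G 5) (h₀₁ : G.Adj v₀ v₁) (h₁₂ : G.Adj v₁ v₂)
    (h₂₃ : G.Adj v₂ v₃) (h₃₄ : G.Adj v₃ v₄) (h₁₃ : v₁ ≠ v₃) (h₀₂ : v₀ ≠ v₂) : v₀ ≠ v₄ := by
  rintro rfl
  have : Link G {v₂} 2 v₁ v₃ :=
    ((Link.refl (n := 0) (by simpa using h₂₃.ne')).cons h₃₄.symm (by simpa using h₀₂)).cons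
      h₀₁.symm (by simpa using h₁₂.ne)
  have := hg.le_of_link h₁₂.symm h₂₃ h₁₃ this rfl
  omega

theorem GirthGE.mono {m n : ℕ} (hg : GirthGE G m) (h : n ≤ m) : GirthGE G n :=
  fun u c hc => h.trans (hg u c hc)

theorem Arc.ne₀₄ (hg : GirthGE G 5) (h : Arc G n v₀ v₁ v₂ v₃ v₄) : v₀ ≠ v₄ :=
  hg.ne_of_path h.adj₀₁ h.adj₁₂ h.adj₂₃ h.adj₃₄ h.ne₁₃ h.ne₀₂

/-- Rotating a closed walk backwards by one step. -/
theorem Arc.shift (hg : GirthGE G 5) (h : Arc G n v₀ v₁ v₂ v₃ v₄) : ∃ s, Arc G n s v₀ v₁ v₂ v₃ := by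
  obtain ⟨m, s, rfl, hs, hl⟩ := h.link.step (h.ne₀₄ hg)
  refine ⟨s, hs.symm, h.adj₀₁, h.adj₁₂, h.adj₂₃, h.ne₀₂, ?_⟩
  refine (hl.mono (T := {v₀, v₁, v₂}) ?_ le_rfl).snoc h.adj₃₄.symm ?_
  · intro; simp; tauto
  · simpa using ⟨h.ne₀₃.symm, h.ne₁₃.symm, h.adj₂₃.ne'⟩

/-- Rotating a closed walk forwards by one step. -/
theorem Arc.unshift (hg : GirthGE G 5) (h : Arc G n v₀ v₁ v₂ v₃ v₄) :
    ∃ s, Arc G n v₁ v₂ v₃ v₄ s :=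
  (h.symm.shift hg).imp fun _ h => h.symm

/-- Short cycles have no chords at their vertices. -/
theorem Arc.link_insert (hg : GirthGE G (k + 4)) (h : Arc G n v₀ v₁ v₂ v₃ v₄) (hn : n ≤ k + 1)
    (hz : G.Adj v₂ z) (h₁ : z ≠ v₁) (h₃ : z ≠ v₃) :
    Link G {v₁, v₂, v₃, z} n v₀ v₄ := by
  rcases h.link.split z with h' | ⟨i, j, hij, hi, hj⟩
  · exact h'.mono (by intro; simp; tauto) le_rfl
  · have h1 : Link G {v₂} (i + 1) v₁ z :=
      (hi.mono (by simp) le_rfl).cons h.adj₀₁.symm (by simpa using h.adj₁₂.ne)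
    have h2 : Link G {v₂} (j + 1) z v₃ :=
      (hj.mono (by simp) le_rfl).snoc h.adj₃₄.symm (by simpa using h.adj₂₃.ne')
    have := hg.le_of_link h.adj₁₂.symm hz h₁.symm h1 rfl
    have := hg.le_of_link hz h.adj₂₃ h₃ h2 rfl
    omega

theorem Arc.link₀₃ (h : Arc G n v₀ v₁ v₂ v₃ v₄) : Link G {v₁, v₂} (n + 1) v₀ v₃ :=
  (h.link.mono (by intro; simp; tauto) le_rfl).snoc h.adj₃₄.symm
    (by simpa using ⟨h.ne₁₃.symm, h.adj₂₃.ne'⟩)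

theorem Arc.link_nbrs_insert (hg : GirthGE G (k + 4)) (h : Arc G n v₀ v₁ v₂ v₃ v₄)
    (hn : n ≤ k + 1) (hz : G.Adj v₂ z) (h₁ : z ≠ v₁) (h₃ : z ≠ v₃) :
    Link G {v₂, z} (n + 2) v₁ v₃ :=
  (((h.link_insert hg hn hz h₁ h₃).mono (by intro; simp; tauto) le_rfl).cons h.adj₀₁.symm
    (by simpa using ⟨h.adj₁₂.ne, h₁.symm⟩)).snoc h.adj₃₄.symm
    (by simpa using ⟨h.adj₂₃.ne', h₃.symm⟩)

theorem Link.exists_arc_left {S : Set V} (h : Link G S (n + 1) v₁ v₄) (h₁₄ : v₁ ≠ v₄)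
    (h₁₂ : G.Adj v₁ v₂) (h₂₃ : G.Adj v₂ v₃) (h₃₄ : G.Adj v₃ v₄) (h₁₃ : v₁ ≠ v₃)
    (h₂ : v₂ ∈ S) (h₃ : v₃ ∈ S) : ∃ v₀, Arc G n v₀ v₁ v₂ v₃ v₄ := by
  obtain ⟨m, v₀, hm, hv₀, hl⟩ := h.step h₁₄
  obtain rfl : n = m := by omega
  refine ⟨v₀, hv₀.symm, h₁₂, h₂₃, h₃₄, h₁₃, hl.mono ?_ le_rfl⟩
  intro w
  simp only [Set.mem_insert_iff, Set.mem_singleton_iff]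
  rintro (rfl | rfl | rfl) <;> simp [h₂, h₃]

end Arc

/-! ### Cubic graphs with equal decks -/

section Deck

variable {V : Type*} {G H H' : SimpleGraph V} {u v w x y p q r s t t' a b c : V} {S : Set V}

/-- The neighbours of `v` are precisely the three distinct vertices `a`, `b`, `c`. -/
structure Nbrs (G : SimpleGraph V) (v a b c : V) : Prop where
  adj_iff : ∀ w, G.Adj v w ↔ w = a ∨ w = b ∨ w = c
  ne₁₂ : a ≠ b
  ne₁₃ : a ≠ c
  ne₂₃ : b ≠ c

theorem Nbrs.adj₁ (h : Nbrs G v a b c) : G.Adj v a := (h.adj_iff a).2 (by simp)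
theorem Nbrs.adj₂ (h : Nbrs G v a b c) : G.Adj v b := (h.adj_iff b).2 (by simp)
theorem Nbrs.adj₃ (h : Nbrs G v a b c) : G.Adj v c := (h.adj_iff c).2 (by simp)

theorem Nbrs.swap₁₂ (h : Nbrs G v a b c) : Nbrs G v b a c :=
  ⟨fun w => (h.adj_iff w).trans (by tauto), h.ne₁₂.symm, h.ne₂₃, h.ne₁₃⟩

theorem Nbrs.swap₂₃ (h : Nbrs G v a b c) : Nbrs G v a c b :=
  ⟨fun w => (h.adj_iff w).trans (by tauto), h.ne₁₃, h.ne₁₂, h.ne₂₃.symm⟩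

/-- Every vertex of `G` has exactly three neighbours. -/
def IsCubic (G : SimpleGraph V) : Prop := ∀ v, (G.neighborSet v).ncard = 3

theorem IsCubic.exists_nbrs (hG : IsCubic G) (v : V) : ∃ a b c, Nbrs G v a b c := by
  obtain ⟨a, b, c, hab, hac, hbc, h⟩ := Set.ncard_eq_three.1 (hG v)
  refine ⟨a, b, c, fun w => ?_, hab, hac, hbc⟩
  rw [← mem_neighborSet, h]; simp

theorem IsCubic.exists_nbrs₁ (hG : IsCubic G) (h : G.Adj v a) : ∃ b c, Nbrs G v a b c := by
  obtain ⟨a', b', c', hn⟩ := hG.exists_nbrs v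
  rcases (hn.adj_iff a).1 h with rfl | rfl | rfl
  exacts [⟨_, _, hn⟩, ⟨_, _, hn.swap₁₂⟩, ⟨_, _, hn.swap₂₃.swap₁₂⟩]

theorem IsCubic.exists_nbrs₂ (hG : IsCubic G) (ha : G.Adj v a) (hb : G.Adj v b) (hab : a ≠ b) :
    ∃ c, Nbrs G v a b c := by
  obtain ⟨b', c', hn⟩ := hG.exists_nbrs₁ ha
  rcases (hn.adj_iff b).1 hb with rfl | rfl | rfl
  exacts [absurd rfl hab, ⟨_, hn⟩, ⟨_, hn.swap₂₃⟩]

theorem IsCubic.nbrs (hG : IsCubic G) (ha : G.Adj v a) (hb : G.Adj v b) (hc : G.Adj v c)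
    (hab : a ≠ b) (hac : a ≠ c) (hbc : b ≠ c) : Nbrs G v a b c := by
  obtain ⟨c', hn⟩ := hG.exists_nbrs₂ ha hb hab
  rcases (hn.adj_iff c).1 hc with rfl | rfl | rfl
  exacts [absurd rfl hac, absurd rfl hbc, hn]

/-- `G` and `H` have the same edges outside `S`. -/
def AgreeOff (G H : SimpleGraph V) (S : Set V) : Prop :=
  ∀ a b, a ∉ S → b ∉ S → (G.Adj a b ↔ H.Adj a b)

theorem AgreeOff.symm (h : AgreeOff G H S) : AgreeOff H G S :=
  fun a b ha hb => (h a b ha hb).symm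

variable [Fintype V] [DecidableEq V]

/-- Two non-isomorphic cubic graphs on the same vertex set with the same `(n - 2)`-deck. -/
structure DeckPair (G H : SimpleGraph V) : Prop where
  cubic_left : IsCubic G
  cubic_right : IsCubic H
  deck : SameDeck G H (Fintype.card V - 2)
  not_iso : ¬ Nonempty (G ≃g H)

theorem DeckPair.symm (h : DeckPair G H) : DeckPair H G := by
  refine ⟨h.2, h.1, ?_, fun ⟨e⟩ => h.4 ⟨e.symm⟩⟩
  obtain ⟨e, he⟩ := h.deck
  refine ⟨e.symm, fun s => ?_⟩
  obtain ⟨φ⟩ := he (e.symm s)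
  rw [e.apply_symm_apply] at φ
  exact ⟨φ.symm⟩

theorem SameDeck.congr_right {U W W' : Type*} [Fintype U] [Fintype W] [Fintype W'] [DecidableEq U]
    [DecidableEq W] [DecidableEq W'] {G : SimpleGraph U} {H : SimpleGraph W}
    {H' : SimpleGraph W'} {k : ℕ} (h : SameDeck G H k) (φ : H ≃g H') : SameDeck G H' k := by
  obtain ⟨e, he⟩ := h
  refine ⟨e.trans (φ.toEquiv.finsetCongr.subtypeEquiv fun s => by simp), fun s => ?_⟩
  obtain ⟨ψ⟩ := he s
  refine ⟨ψ.trans ⟨φ.toEquiv.subtypeEquiv fun a => by simp, ?_⟩⟩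
  intro a b
  exact φ.map_adj_iff

theorem DeckPair.congr_right (h : DeckPair G H) (φ : H ≃g H') : DeckPair G H' := by
  refine ⟨h.1, fun v => ?_, h.3.congr_right φ, fun ⟨e⟩ => h.4 ⟨e.trans φ.symm⟩⟩
  rw [← h.2 (φ.symm v), ← Set.ncard_image_of_injective (H.neighborSet _) φ.injective]
  congr 1
  ext w
  simp only [mem_neighborSet, Set.mem_image]
  constructor
  · intro hw
    exact ⟨φ.symm w, by simpa using φ.symm.map_adj_iff.2 hw, by simp⟩
  · rintro ⟨w, hw, rfl⟩
    simpa using φ.map_adj_iff.2 hw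

/-- A graph with the same deck can be placed so as to agree with `G` off two given vertices. -/
theorem DeckPair.exists_agreeOff (h : DeckPair G H) (hxy : x ≠ y) :
    ∃ H', Nonempty (H ≃g H') ∧ AgreeOff G H' {x, y} := by
  obtain ⟨e, he⟩ := h.deck
  have hs : ({x, y}ᶜ : Finset V).card = Fintype.card V - 2 := by
    rw [Finset.card_compl, Finset.card_pair hxy]
  obtain ⟨φ⟩ := he ⟨_, hs⟩
  set t := (e ⟨_, hs⟩).1
  let σ : Equiv.Perm V :=
    Equiv.extendSubtype (p := (· ∈ ({x, y}ᶜ : Finset V))) (q := (· ∈ t)) φ.toEquiv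
  refine ⟨H.comap σ, ⟨(Iso.comap σ H).symm⟩, fun a b ha hb => ?_⟩
  have ha' : a ∈ ({x, y}ᶜ : Finset V) := by simpa using ha
  have hb' : b ∈ ({x, y}ᶜ : Finset V) := by simpa using hb
  rw [comap_adj, Equiv.extendSubtype_apply_of_mem _ _ ha', Equiv.extendSubtype_apply_of_mem _ _ hb']
  exact (φ.map_adj_iff (v := ⟨a, ha'⟩) (w := ⟨b, hb'⟩)).symm

open Classical in
omit [DecidableEq V] in
theorem IsCubic.sum_eq (hG : IsCubic G) (v : V) : (∑ u, if G.Adj u v then 1 else 0) = 3 := by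
  rw [← hG v, ← Finset.card_filter, ← Set.ncard_coe_finset]
  congr 1
  ext; simp [G.adj_comm]

omit [Fintype V] [DecidableEq V] in
theorem IsCubic.eq_of_forall_adj (hG : IsCubic G) (hH : IsCubic H)
    (h : ∀ w, G.Adj v w → H.Adj v w) : G.Adj v w ↔ H.Adj v w := by
  have : G.neighborSet v = H.neighborSet v := by
    refine Set.eq_of_subset_of_ncard_le (fun w hw => h w hw) (by rw [hG v, hH v]) ?_
    exact Set.finite_of_ncard_ne_zero (by rw [hH v]; simp)
  rw [← mem_neighborSet, this, mem_neighborSet]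

/-- Two cubic graphs on the same vertex set which agree off `{x, y}` and in which every other
vertex has equally many neighbours in `{x, y}`. -/
structure Switch (G H : SimpleGraph V) (x y : V) : Prop where
  agree : AgreeOff G H {x, y}
  adj_iff : G.Adj x y ↔ H.Adj x y
  or_iff : ∀ u, u ≠ x → u ≠ y → (G.Adj x u ∨ G.Adj y u ↔ H.Adj x u ∨ H.Adj y u)
  and_iff : ∀ u, u ≠ x → u ≠ y → (G.Adj x u ∧ G.Adj y u ↔ H.Adj x u ∧ H.Adj y u)

open Classical in
theorem AgreeOff.switch (h : AgreeOff G H {x, y}) (hG : IsCubic G) (hH : IsCubic H) (hxy : x ≠ y) :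
    Switch G H x y := by
  have key (f : V → ℕ) : ∑ w, f w = f x + f y + ∑ w ∈ {x, y}ᶜ, f w := by
    rw [← Finset.sum_add_sum_compl {x, y}, Finset.sum_pair hxy]
  have hu (u : V) (hux : u ≠ x) (huy : u ≠ y) :
      ((if G.Adj x u then 1 else 0) + (if G.Adj y u then 1 else 0) : ℕ) =
        (if H.Adj x u then 1 else 0) + (if H.Adj y u then 1 else 0) := by
    have h1 := hG.sum_eq u
    have h2 := hH.sum_eq u
    rw [key] at h1 h2
    have : (∑ w ∈ {x, y}ᶜ, if G.Adj w u then 1 else 0) =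
        ∑ w ∈ {x, y}ᶜ, if H.Adj w u then 1 else 0 := by
      refine Finset.sum_congr rfl fun w hw => ?_
      have := h w u (by simpa using hw) (by simpa using ⟨hux, huy⟩)
      simp only [this]
    omega
  refine ⟨h, ?_, fun u hux huy => ?_, fun u hux huy => ?_⟩
  · have hx := hG.sum_eq x
    have hy := hG.sum_eq y
    have hx' := hH.sum_eq x
    have hy' := hH.sum_eq y
    rw [key] at hx hy hx' hy'
    have : (∑ w ∈ {x, y}ᶜ, if G.Adj w x then 1 else 0) +
        (∑ w ∈ {x, y}ᶜ, if G.Adj w y then 1 else 0) =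
        (∑ w ∈ {x, y}ᶜ, if H.Adj w x then 1 else 0) +
        ∑ w ∈ {x, y}ᶜ, if H.Adj w y then 1 else 0 := by
      rw [← Finset.sum_add_distrib, ← Finset.sum_add_distrib]
      refine Finset.sum_congr rfl fun w hw => ?_
      simp only [Finset.mem_compl, Finset.mem_insert, Finset.mem_singleton, not_or] at hw
      simpa only [G.adj_comm w, H.adj_comm w] using hu w hw.1 hw.2
    simp only [G.irrefl, H.irrefl, if_false, G.adj_comm y x, H.adj_comm y x] at hx hy hx' hy'
    by_cases h1 : G.Adj x y <;> by_cases h2 : H.Adj x y <;>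
      simp only [h1, h2, if_true, if_false] at hx hy hx' hy' ⊢ <;> omega
  all_goals
    have := hu u hux huy
    by_cases h1 : G.Adj x u <;> by_cases h2 : G.Adj y u <;> by_cases h3 : H.Adj x u <;>
      by_cases h4 : H.Adj y u <;> simp_all

omit [Fintype V] [DecidableEq V] in
/-- If `x` has the same neighbours in both graphs of a switch, then the graphs are equal. -/
theorem Switch.eq_of_forall_adj (h : Switch G H x y) (hG : IsCubic G) (hH : IsCubic H)
    (hx : ∀ w, G.Adj x w → H.Adj x w) : G = H := by
  have hx' (w) : G.Adj x w ↔ H.Adj x w := hG.eq_of_forall_adj hH hx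
  have hy (w) : G.Adj y w ↔ H.Adj y w := by
    by_cases h1 : w = x
    · subst h1; rw [G.adj_comm, h.2, H.adj_comm]
    by_cases h2 : w = y
    · subst h2; simp
    have := h.3 w h1 h2
    have := h.4 w h1 h2
    have := hx' w
    tauto
  ext a b
  by_cases ha : a = x
  · subst ha; exact hx' b
  by_cases ha' : a = y
  · subst ha'; exact hy b
  by_cases hb : b = x
  · subst hb; rw [G.adj_comm, H.adj_comm]; exact hx' a
  by_cases hb' : b = y
  · subst hb'; rw [G.adj_comm, H.adj_comm]; exact hy a
  exact h.1 a b (by simp [ha, ha']) (by simp [hb, hb'])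

/-- A switched copy of the second graph, with one edge kept in place. -/
theorem DeckPair.exists_switch (h : DeckPair G H) (hxy : x ≠ y) (hxp : G.Adj x p) :
    ∃ H', Nonempty (H ≃g H') ∧ Switch G H' x y ∧ H'.Adj x p := by
  obtain ⟨H', ⟨φ⟩, hH'⟩ := h.exists_agreeOff hxy
  have h' := h.congr_right φ
  have hs := hH'.switch h'.1 h'.2 hxy
  by_cases hp : H'.Adj x p
  · exact ⟨H', ⟨φ⟩, hs, hp⟩
  have hpx : p ≠ x := hxp.ne'
  have hpy : p ≠ y := by rintro rfl; exact hp (hs.2.1 hxp)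
  let σ := Equiv.swap x y
  have φ' : H' ≃g H'.comap σ := (Iso.comap σ H').symm
  have h'' := h'.congr_right φ'
  refine ⟨H'.comap σ, ⟨φ.trans φ'⟩, AgreeOff.switch ?_ h''.1 h''.2 hxy, ?_⟩
  · intro a b ha hb
    simp only [Set.mem_insert_iff, Set.mem_singleton_iff, not_or] at ha hb
    rw [comap_adj, Equiv.swap_apply_of_ne_of_ne ha.1 ha.2, Equiv.swap_apply_of_ne_of_ne hb.1 hb.2]
    exact hH' a b (by simpa using ha) (by simpa using hb)
  · rw [comap_adj, Equiv.swap_apply_left, Equiv.swap_apply_of_ne_of_ne hpx hpy]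
    exact ((hs.3 p hpx hpy).1 (Or.inl hxp)).resolve_left hp

/-- Two vertices never have almost the same neighbourhoods. -/
theorem DeckPair.not_almost_twins (h : DeckPair G H) (hxy : x ≠ y) (hxp : G.Adj x p)
    (hp : ∀ u, G.Adj x u → u = y ∨ u = p ∨ G.Adj y u) : False := by
  obtain ⟨H', ⟨φ⟩, hs, hxp'⟩ := h.exists_switch hxy hxp
  have h' := h.congr_right φ
  have : G = H' := by
    refine hs.eq_of_forall_adj h'.1 h'.2 fun u hu => ?_
    rcases hp u hu with rfl | rfl | hyu
    · exact hs.2.1 hu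
    · exact hxp'
    · by_cases huy : u = y
      · subst huy; exact hs.2.1 hu
      exact ((hs.4 u hu.ne' huy).1 ⟨hu, hyu⟩).1
  subst this
  exact h'.4 ⟨Iso.refl⟩

theorem DeckPair.no_triangle (h : DeckPair G H) (hab : G.Adj a b) (hbc : G.Adj b c)
    (hca : G.Adj c a) : False := by
  obtain ⟨d, hd⟩ := h.1.exists_nbrs₂ hab hca.symm hbc.ne
  refine h.not_almost_twins hab.ne hd.adj₃ fun u hu => ?_
  rcases (hd.adj_iff u).1 hu with rfl | rfl | rfl <;> tauto

theorem DeckPair.no_square (h : DeckPair G H) (hax : G.Adj a x) (hay : G.Adj a y)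
    (hbx : G.Adj b x) (hby : G.Adj b y) (hab : a ≠ b) (hxy : x ≠ y) : False := by
  obtain ⟨d, hd⟩ := h.1.exists_nbrs₂ hax hay hxy
  refine h.not_almost_twins hab hd.adj₃ fun u hu => ?_
  rcases (hd.adj_iff u).1 hu with rfl | rfl | rfl <;> tauto

/-- Two disjoint pairs of neighbours of `x` and `y` can be exchanged. -/
theorem DeckPair.exists_switch_nbrs (h : DeckPair G H) (hxy : x ≠ y) (hx : Nbrs G x t p q)
    (hy : Nbrs G y t' r s) (ht : t = y ∧ t' = x ∨ t = t') :
    ∃ H', Nonempty (H ≃g H') ∧ AgreeOff G H' {x, y} ∧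
      (Nbrs H' x t p r ∧ Nbrs H' y t' q s ∨ Nbrs H' x t p s ∧ Nbrs H' y t' q r) := by
  have common (u) (h₁ : G.Adj x u) (h₂ : G.Adj y u) : u = t ∧ u = t' := by
    rcases ht with ⟨rfl, rfl⟩ | rfl
    · exact (h.no_triangle h₁ h₂.symm hx.adj₁.symm).elim
    · by_contra hu
      exact h.no_square hx.adj₁ h₁ hy.adj₁ h₂ hxy fun hut => hu ⟨hut.symm, hut.symm⟩
  have hadj (hxy' : G.Adj x y) : t = y ∧ t' = x := by
    rcases ht with ht | rfl
    · exact ht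
    · exact (h.no_triangle hx.adj₁ hy.adj₁.symm hxy'.symm).elim
  have hp : ¬ G.Adj y p := fun hp => hx.ne₁₂ (common p hx.adj₂ hp).1.symm
  have hq : ¬ G.Adj y q := fun hq => hx.ne₁₃ (common q hx.adj₃ hq).1.symm
  have hr : ¬ G.Adj x r := fun hr => hy.ne₁₂ (common r hr hy.adj₂).2.symm
  have hs' : ¬ G.Adj x s := fun hs => hy.ne₁₃ (common s hs hy.adj₃).2.symm
  have hpy : p ≠ y := by
    rintro rfl; exact hx.ne₁₂ (hadj hx.adj₂).1
  have hqy : q ≠ y := by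
    rintro rfl; exact hx.ne₁₃ (hadj hx.adj₃).1
  have hrx : r ≠ x := by
    rintro rfl; exact hy.ne₁₂ (hadj hy.adj₂.symm).2
  have hsx : s ≠ x := by
    rintro rfl; exact hy.ne₁₃ (hadj hy.adj₃.symm).2
  have hpr : p ≠ r := by rintro rfl; exact hp hy.adj₂
  have hps : p ≠ s := by rintro rfl; exact hp hy.adj₃
  have hqr : q ≠ r := by rintro rfl; exact hq hy.adj₂
  have hqs : q ≠ s := by rintro rfl; exact hq hy.adj₃
  obtain ⟨H', ⟨φ⟩, hs, hxp'⟩ := h.exists_switch hxy hx.adj₂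
  have h' := h.congr_right φ
  refine ⟨H', ⟨φ⟩, hs.1, ?_⟩
  have hxyt : H'.Adj x t ∧ H'.Adj y t' := by
    rcases ht with ⟨rfl, rfl⟩ | rfl
    · exact ⟨hs.2.1 hx.adj₁, (hs.2.1 hx.adj₁).symm⟩
    · exact (hs.4 t hx.adj₁.ne' hy.adj₁.ne').1 ⟨hx.adj₁, hy.adj₁⟩
  obtain ⟨w, hw⟩ := h'.2.exists_nbrs₂ hxyt.1 hxp' hx.ne₁₂
  have hxw := hw.adj₃
  have hwy : w ≠ y := by
    rintro rfl
    exact hw.ne₁₃ (hadj (hs.2.2 hxw)).1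
  have hwG := (hs.3 w hxw.ne' hwy).2 (Or.inl hxw)
  have hyq (hwq : w ≠ q) : H'.Adj y q := by
    refine ((hs.3 q hx.adj₃.ne' hqy).1 (Or.inl hx.adj₃)).resolve_left fun hq' => ?_
    rcases (hw.adj_iff q).1 hq' with h | h | h
    exacts [hx.ne₁₃ h.symm, hx.ne₂₃ h.symm, hwq h.symm]
  rw [hx.adj_iff, hy.adj_iff] at hwG
  rcases hwG with (rfl | rfl | rfl) | (rfl | rfl | rfl)
  · exact absurd rfl hw.ne₁₃
  · exact absurd rfl hw.ne₂₃
  · refine (h'.4 ?_).elim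
    rw [hs.eq_of_forall_adj h'.1 h'.2 fun u hu => (hw.adj_iff u).2 ((hx.adj_iff u).1 hu)]
    exact ⟨Iso.refl⟩
  · rcases ht with ⟨rfl, rfl⟩ | rfl
    · exact absurd hxw H'.irrefl
    · exact absurd rfl hw.ne₁₃
  · left
    have hys : H'.Adj y s := by
      refine ((hs.3 s hsx hy.adj₃.ne').1 (Or.inr hy.adj₃)).resolve_left fun hs'' => ?_
      rcases (hw.adj_iff s).1 hs'' with rfl | h | h
      exacts [hs' hx.adj₁, hps h.symm, hy.ne₂₃ h.symm]
    refine ⟨hw, h'.2.nbrs hxyt.2 (hyq hqr.symm) hys ?_ hy.ne₁₃ hqs⟩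
    rintro rfl; exact hq hy.adj₁
  · right
    have hyr : H'.Adj y r := by
      refine ((hs.3 r hrx hy.adj₂.ne').1 (Or.inr hy.adj₂)).resolve_left fun hs'' => ?_
      rcases (hw.adj_iff r).1 hs'' with rfl | h | h
      exacts [hr hx.adj₁, hpr h.symm, hy.ne₂₃ h]
    refine ⟨hw, h'.2.nbrs hxyt.2 (hyq hqs.symm) hyr ?_ hy.ne₁₂ hqr⟩
    rintro rfl; exact hq hy.adj₁
end Deck

/-! ### Cycles and links -/

section Cycle

variable {V : Type*} {G H : SimpleGraph V} {S : Set V} {n k : ℕ} {u v x y a b c v₀ v₁ v₂ v₃ v₄ : V}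

/-- Deleting a vertex from a cycle leaves a path. -/
theorem SimpleGraph.Walk.IsCycle.exists_isPath {C : G.Walk u u} (hC : C.IsCycle)
    (hb : b ∈ C.support) :
    ∃ (x y : V) (q : G.Walk x y), q.IsPath ∧ G.Adj b x ∧ G.Adj b y ∧ x ≠ y ∧ b ∉ q.support ∧
      q.length + 2 = C.length ∧ (∀ e, e ∈ C.edges ↔ e = s(b, x) ∨ e = s(b, y) ∨ e ∈ q.edges) ∧
      ∀ z, z ∈ C.support ↔ z = b ∨ z ∈ q.support := by
  classical
  have hD := hC.rotate hb
  have hlen : (C.rotate b hb).length = C.length := by simp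
  have hed (e) : e ∈ C.edges ↔ e ∈ (C.rotate b hb).edges := (C.rotate_edges b hb).mem_iff.symm
  have hsu (z) : z ∈ C.support ↔ z ∈ (C.rotate b hb).support := by
    simp
  generalize C.rotate b hb = D at hD hlen hed hsu
  cases D with
  | nil => simp at hD
  | @cons _ x _ hbx p =>
    rw [Walk.cons_isCycle_iff] at hD
    obtain ⟨hp, hx⟩ := hD
    obtain ⟨r, hr⟩ : ∃ r, r = p.reverse := ⟨_, rfl⟩
    have hpr : p = r.reverse := by simp [hr]
    subst hpr
    clear hr
    cases r with
    | nil => simp at hbx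
    | @cons _ y _ hby q =>
      rw [Walk.isPath_reverse_iff, Walk.cons_isPath_iff] at hp
      refine ⟨x, y, q.reverse, hp.1.reverse, hbx, hby, ?_, by simpa using hp.2, ?_, ?_, ?_⟩
      · rintro rfl; simp at hx
      · rw [← hlen]; simp
      · intro e; rw [hed, Sym2.eq_swap (a := b) (b := y)]; simp; tauto
      · intro z; rw [hsu]; simp; grind [Walk.start_mem_support]

/-- Splitting a cycle at two consecutive edges. -/
theorem SimpleGraph.Walk.IsCycle.exists_isPath_of_mem_edges {C : G.Walk u u} (hC : C.IsCycle)
    (hab : s(a, b) ∈ C.edges) (hbc : s(b, c) ∈ C.edges) (hac : a ≠ c) :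
    ∃ q : G.Walk c a, q.IsPath ∧ b ∉ q.support ∧ q.length + 2 = C.length ∧
      ∀ e, e ∈ C.edges ↔ e = s(a, b) ∨ e = s(b, c) ∨ e ∈ q.edges := by
  obtain ⟨x, y, q, hq, hx, hy, hxy, hb, hl, he, -⟩ :=
    hC.exists_isPath (C.snd_mem_support_of_mem_edges hab)
  have key (z) (hz : s(b, z) ∈ C.edges) : z = x ∨ z = y := by
    rcases (he _).1 hz with h | h | h
    · left; have := hx.ne; grind [Sym2.eq_iff]
    · right; have := hy.ne; grind [Sym2.eq_iff]
    · exact (hb (q.fst_mem_support_of_mem_edges h)).elim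
  rw [Sym2.eq_swap] at hab
  rcases key a hab with rfl | rfl <;> rcases key c hbc with rfl | rfl
  · exact absurd rfl hac
  · refine ⟨q.reverse, hq.reverse, by simpa using hb, by simpa using hl, fun e => ?_⟩
    rw [he, Sym2.eq_swap]; simp
  · refine ⟨q, hq, hb, hl, fun e => ?_⟩
    rw [he, Sym2.eq_swap (a := a)]; tauto
  · exact absurd rfl hac

/-- Two neighbours of a vertex joined by a link belong to a short closed walk. -/
theorem Link.exists_arc (hg : GirthGE G 5) (h : Link G S (n + 2) x y) (hx : G.Adj b x)
    (hy : G.Adj b y) (hxy : x ≠ y) (hb : b ∈ S) : ∃ v₀ v₄, Arc G n v₀ x b y v₄ := by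
  obtain ⟨m, v₀, hm, hv₀, h₁⟩ := h.step hxy
  have h₀y : v₀ ≠ y := by
    rintro rfl
    have := hg.le_of_link (S := {b}) (n := 1) hx hy hxy
      ((Link.refl (n := 0) (by simpa using hy.ne')).cons hv₀ (by simpa using hx.ne')) rfl
    omega
  obtain ⟨m', v₄, hm', hv₄, h₂⟩ := h₁.symm.step h₀y.symm
  obtain rfl : m' = n := by omega
  refine ⟨v₀, v₄, hv₀.symm, hx.symm, hy, hv₄, hxy, h₂.symm.mono ?_ le_rfl⟩
  intro z
  simp only [Set.mem_insert_iff, Set.mem_singleton_iff]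
  rintro (rfl | rfl | rfl) <;> simp [hb]

theorem SimpleGraph.Walk.IsCycle.exists_arc (hg : GirthGE G 5) {C : G.Walk u u} (hC : C.IsCycle)
    (hn : C.length ≤ n + 4) : ∃ v₀ v₁ v₂ v₃ v₄, Arc G n v₀ v₁ v₂ v₃ v₄ := by
  obtain ⟨x, y, q, hq, hx, hy, hxy, hb, hl, -⟩ := hC.exists_isPath C.start_mem_support
  have : Link G {u} (n + 2) x y := ⟨q, by omega, fun z hz hzu => hb (hzu ▸ hz)⟩
  obtain ⟨v₀, v₄, h⟩ := this.exists_arc hg hx hy hxy rfl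
  exact ⟨_, _, _, _, _, h⟩

theorem GirthGE.congr {m : ℕ} {W : Type*} {H : SimpleGraph W} (hg : GirthGE G m) (φ : G ≃g H) :
    GirthGE H m := by
  intro u c hc
  have := hg _ _ ((Walk.isCycle_map_iff_of_injective (f := φ.symm.toHom) φ.symm.injective).2 hc)
  simpa using this

/-- There are two vertices outside a shortest cycle. -/
theorem GirthGE.le_card [Fintype V] [DecidableEq V] (hG : IsCubic G) (hk : 1 ≤ k)
    (hg : GirthGE G (k + 4)) {C : G.Walk u u} (hC : C.IsCycle) (hn : C.length ≤ k + 4) :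
    k + 6 ≤ Fintype.card V := by
  have hg5 : GirthGE G 5 := hg.mono (by omega)
  obtain ⟨v₀, v₁, v₂, v₃, v₄, h⟩ := hC.exists_arc hg5 hn
  obtain ⟨z, hz⟩ := hG.exists_nbrs₂ h.adj₁₂.symm h.adj₂₃ h.ne₁₃
  obtain ⟨z', hz'⟩ := hG.exists_nbrs₂ h.adj₂₃.symm h.adj₃₄ h.ne₂₄
  have hl := h.link_insert hg (Nat.le_succ k) hz.adj₃ hz.ne₁₃.symm hz.ne₂₃.symm
  have hzz' : z' ≠ z := by
    rintro rfl
    have := hg5.le_of_link (S := {v₂}) (n := 1) h.adj₂₃ hz.adj₃ hz.ne₂₃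
      ((Link.refl (n := 0) (by simpa using hz.adj₃.ne')).cons hz'.adj₃
        (by simpa using h.adj₂₃.ne')) rfl
    omega
  have hz'1 : z' ≠ v₁ := by
    rintro rfl
    have := hg5.le_of_link (S := {v₂}) (n := 1) h.adj₁₂.symm h.adj₂₃ h.ne₁₃
      ((Link.refl (n := 0) (by simpa using h.adj₂₃.ne')).cons hz'.adj₃.symm
        (by simpa using h.adj₁₂.ne)) rfl
    omega
  rcases hl.split z' with hl' | ⟨i, j, hij, hi, hj⟩
  · obtain ⟨p, hp, -, hS⟩ := hl'.exists_isPath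
    have hpl := hg.le_of_link (S := {v₂}) (n := p.length + 2) h.adj₁₂.symm h.adj₂₃ h.ne₁₃
      (((Link.cons (v := v₀) ⟨p, le_rfl, fun z hz hz2 => hS z hz (by
        simp only [Set.mem_singleton_iff] at hz2; simp [hz2])⟩ h.adj₀₁.symm
          (by simpa using h.adj₁₂.ne))).snoc h.adj₃₄.symm (by simpa using h.adj₂₃.ne')) rfl
    have h5 : ({z', v₁, v₂, v₃, z} : Finset V).card = 5 := by
      have := h.adj₁₂.ne
      have := h.adj₂₃.ne
      have := h.ne₁₃
      have := hz.ne₁₃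
      have := hz.ne₂₃
      have := hz.adj₃.ne
      have := hz'.ne₁₃
      have := hz'.adj₃.ne'
      rw [Finset.card_insert_of_notMem, Finset.card_insert_of_notMem, Finset.card_insert_of_notMem,
        Finset.card_insert_of_notMem, Finset.card_singleton] <;> simp <;> tauto
    have hdis : Disjoint p.support.toFinset ({z', v₁, v₂, v₃, z} : Finset V) := by
      rw [Finset.disjoint_left]
      intro w hw hw'
      exact hS w (by simpa using hw) (by simpa using hw')
    have := Finset.card_le_univ (p.support.toFinset ∪ {z', v₁, v₂, v₃, z})
    rw [Finset.card_union_of_disjoint hdis, h5, List.toFinset_card_of_nodup hp.support_nodup,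
      Walk.length_support] at this
    omega
  · have := hg.le_of_link hz'.adj₃ h.adj₃₄ hz'.ne₂₃.symm hj (by simp)
    omega

end Cycle

/-! ### Comparing short cycles -/

section Mate

variable {V : Type*} [Fintype V] [DecidableEq V] {G H H' : SimpleGraph V} {k : ℕ}

theorem DeckPair.exists_perm (h : DeckPair G H) :
    ∃ e : {s : Finset V // s.card = Fintype.card V - 2} ≃
        {s : Finset V // s.card = Fintype.card V - 2},
      ∀ s, ∃ σ : Equiv.Perm V, (∀ a ∈ s.1, σ a ∈ (e s).1) ∧
        ∀ a ∈ s.1, ∀ b ∈ s.1, G.Adj a b → H.Adj (σ a) (σ b) := by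
  obtain ⟨e, he⟩ := h.deck
  refine ⟨e, fun s => ?_⟩
  obtain ⟨φ⟩ := he s
  let ψ : {x // x ∈ s.1} ≃ {x // x ∈ (e s).1} := φ.toEquiv
  refine ⟨ψ.extendSubtype, fun a ha => ψ.extendSubtype_mem a ha, fun a ha b hb hab => ?_⟩
  rw [Equiv.extendSubtype_apply_of_mem _ _ ha, Equiv.extendSubtype_apply_of_mem _ _ hb]
  exact (φ.map_adj_iff (v := ⟨a, ha⟩) (w := ⟨b, hb⟩)).2 hab

omit [Fintype V] in
theorem SimpleGraph.Walk.IsCycle.exists_map_perm {u : V} {C : G.Walk u u} (hC : C.IsCycle)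
    {s : Finset V} {σ : Equiv.Perm V} (hs : ∀ a ∈ s, ∀ b ∈ s, G.Adj a b → H.Adj (σ a) (σ b))
    (hCs : ∀ z ∈ C.support, z ∈ s) :
    ∃ (v : V) (D : H.Walk v v), D.IsCycle ∧ D.length = C.length ∧
      D.support.toFinset = C.support.toFinset.map σ.toEmbedding := by
  have hpH : ∀ e ∈ C.edges, e ∈ (H.comap σ).edgeSet := by
    intro e he
    induction e with
    | _ a b =>
      exact hs a (hCs a (C.fst_mem_support_of_mem_edges he)) b
        (hCs b (C.snd_mem_support_of_mem_edges he)) (C.adj_of_mem_edges he)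
  refine ⟨_, (C.transfer _ hpH).map (Iso.comap σ H).toHom, ?_,
    by rw [Walk.length_map, Walk.length_transfer], ?_⟩
  · exact (Walk.isCycle_map_iff_of_injective (Iso.comap σ H).injective).2 (hC.transfer hpH)
  · ext z
    rw [Walk.support_map, Walk.support_transfer]
    simp only [List.mem_toFinset, List.mem_map, Finset.mem_map]
    rfl

/-- The vertex sets of the cycles of length `k + 4`. -/
def cycleSets (G : SimpleGraph V) (k : ℕ) : Set (Finset V) :=
  {T | ∃ (u : V) (C : G.Walk u u), C.IsCycle ∧ C.length = k + 4 ∧ C.support.toFinset = T}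

omit [Fintype V] in
theorem SimpleGraph.Walk.IsCycle.card_support {u : V} {C : G.Walk u u} (hC : C.IsCycle) :
    C.support.toFinset.card = C.length := by
  have h : C.support.toFinset = C.support.tail.toFinset := by
    rw [← C.cons_tail_support]
    ext z
    simp only [List.toFinset_cons, List.tail_cons, Finset.mem_insert, List.mem_toFinset]
    constructor
    · rintro (rfl | hz)
      · exact C.end_mem_tail_support hC.not_nil
      · exact hz
    · exact Or.inr
  rw [h, List.toFinset_card_of_nodup hC.support_nodup]
  simp

theorem DeckPair.girthGE (h : DeckPair G H) {m : ℕ} (hg : GirthGE G m)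
    (hm : m ≤ Fintype.card V - 2) : GirthGE H m := by
  intro u C hC
  by_contra! hlt
  obtain ⟨e, he⟩ := h.symm.exists_perm
  obtain ⟨s, hs, hcard⟩ := Finset.exists_superset_card_eq (s := C.support.toFinset)
    (n := Fintype.card V - 2) (by rw [hC.card_support]; omega) (by omega)
  obtain ⟨σ, -, hσ⟩ := he ⟨s, hcard⟩
  obtain ⟨v, D, hD, hl, -⟩ := hC.exists_map_perm hσ fun z hz => hs (by simpa using hz)
  have := hg _ D hD
  omega

open Classical in
theorem DeckPair.ncard_cycleSets_le (h : DeckPair G H) (hk : k + 6 ≤ Fintype.card V) :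
    (cycleSets G k).ncard ≤ (cycleSets H k).ncard := by
  set n := Fintype.card V
  have hM (F : SimpleGraph V) (T) (hT : T ∈ (cycleSets F k).toFinset) :
      (Finset.univ.filter fun s : {s : Finset V // s.card = n - 2} => T ⊆ s.1).card =
        (n - (k + 4)).choose 2 := by
    obtain ⟨u, C, hC, hl, rfl⟩ := Set.mem_toFinset.1 hT
    rw [← hl, ← hC.card_support, ← Finset.card_compl, ← Finset.card_powersetCard]
    refine Finset.card_bij (fun s _ => s.1ᶜ) ?_ ?_ ?_
    · intro s hs
      simp only [Finset.mem_filter, Finset.mem_univ, true_and] at hs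
      rw [Finset.mem_powersetCard, Finset.card_compl, s.2]
      exact ⟨Finset.compl_subset_compl.2 hs, by omega⟩
    · intro s _ t _ hst
      exact Subtype.ext (compl_injective hst)
    · intro t ht
      rw [Finset.mem_powersetCard] at ht
      refine ⟨⟨tᶜ, by rw [Finset.card_compl, ht.2]⟩, ?_, by simp⟩
      simpa using Finset.subset_compl_comm.1 ht.1
  have hcount (F : SimpleGraph V) : (cycleSets F k).ncard * (n - (k + 4)).choose 2 =
      ∑ s : {s : Finset V // s.card = n - 2},
        ((cycleSets F k).toFinset.filter fun T => T ⊆ s.1).card := by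
    rw [Set.ncard_eq_toFinset_card', ← smul_eq_mul, ← Finset.sum_const,
      ← Finset.sum_congr rfl (hM F)]
    exact Finset.sum_card_bipartiteAbove_eq_sum_card_bipartiteBelow
      fun (T : Finset V) (s : {s : Finset V // s.card = n - 2}) => T ⊆ s.1
  have hpos : 0 < (n - (k + 4)).choose 2 := Nat.choose_pos (by omega)
  refine Nat.le_of_mul_le_mul_right ?_ hpos
  obtain ⟨e, he⟩ := h.exists_perm
  rw [hcount, hcount]
  conv_rhs => rw [← Equiv.sum_comp e]
  refine Finset.sum_le_sum fun s _ => ?_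
  obtain ⟨σ, hσs, hσ⟩ := he s
  refine Finset.card_le_card_of_injOn (fun T => T.map σ.toEmbedding) ?_
    ((Finset.map_injective _).injOn)
  intro T hT
  simp only [Finset.coe_filter, Set.mem_toFinset, Set.mem_ofPred_eq] at hT ⊢
  obtain ⟨⟨u, C, hC, hl, rfl⟩, hT⟩ := hT
  obtain ⟨v, D, hD, hl', hDs⟩ := hC.exists_map_perm hσ fun z hz => hT (by simpa using hz)
  refine ⟨⟨_, D, hD, hl'.trans hl, hDs⟩, ?_⟩
  intro z hz
  obtain ⟨w, hw, rfl⟩ := Finset.mem_map.1 hz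
  exact hσs w (hT hw)

/-- Two non-isomorphic cubic graphs with the same `(n - 2)`-deck and girth at least `k + 4`. -/
structure Mate (k : ℕ) (G H : SimpleGraph V) : Prop extends DeckPair G H where
  one_le : 1 ≤ k
  girth_left : GirthGE G (k + 4)
  girth_right : GirthGE H (k + 4)
  le_card : k + 6 ≤ Fintype.card V

theorem Mate.symm (h : Mate k G H) : Mate k H G :=
  ⟨h.1.symm, h.2, h.4, h.3, h.5⟩

theorem Mate.congr_right (h : Mate k G H) (φ : H ≃g H') : Mate k G H' :=
  ⟨h.1.congr_right φ, h.2, h.3, h.4.congr φ, h.5⟩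

theorem Mate.girth_five (h : Mate k G H) : GirthGE G 5 :=
  h.girth_left.mono (by have := h.one_le; omega)

theorem Mate.cycleSets_eq_of_subset (h : Mate k G H) (hs : cycleSets G k ⊆ cycleSets H k) :
    cycleSets G k = cycleSets H k :=
  Set.eq_of_subset_of_ncard_le hs (h.symm.1.ncard_cycleSets_le h.5) (Set.toFinite _)

end Mate

/-! ### Exchanging neighbours along an edge or a path of length two -/

section Exchange

variable {V : Type*} [Fintype V] [DecidableEq V] {G H : SimpleGraph V} {S T : Set V} {k n : ℕ}
  {u v x y p q r s t t' : V}

omit [Fintype V] [DecidableEq V] in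
theorem Link.of_agreeOff (h : Link G T n u v) (hag : AgreeOff G H S) (hST : S ⊆ T) :
    Link H T n u v :=
  h.transfer fun a b ha hb => (hag a b (fun h => ha (hST h)) fun h => hb (hST h)).1

theorem Mate.exists_switch (h : Mate k G H) (hxy : x ≠ y) (hx : Nbrs G x t p q)
    (hy : Nbrs G y t' r s) (ht : t = y ∧ t' = x ∨ t = t') :
    ∃ H', Mate k G H' ∧ AgreeOff G H' {x, y} ∧
      (Nbrs H' x t p r ∧ Nbrs H' y t' q s ∨ Nbrs H' x t p s ∧ Nbrs H' y t' q r) := by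
  obtain ⟨H', ⟨φ⟩, h'⟩ := h.1.exists_switch_nbrs hxy hx hy ht
  exact ⟨H', h.congr_right φ, h'⟩

omit [Fintype V] [DecidableEq V] in
/-- A shortest cycle through `x` but not through the neighbour `y` of `x`. -/
theorem SimpleGraph.Walk.IsCycle.link {C : G.Walk u u} (hC : C.IsCycle) (hl : C.length = k + 4)
    (hN : Nbrs G x y p q) (hx : x ∈ C.support) (hy : y ∉ C.support) :
    Link G {x, y} (k + 2) p q := by
  obtain ⟨v, w, P, hP, hv, hw, hvw, hxP, hlen, -, hs⟩ := hC.exists_isPath hx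
  have hlink : Link G {x, y} (k + 2) v w := by
    refine ⟨P, by omega, fun z hz => ?_⟩
    rintro (rfl | rfl)
    · exact hxP hz
    · exact hy ((hs _).2 (Or.inr hz))
  rcases (hN.adj_iff v).1 hv with rfl | rfl | rfl
  · exact absurd (Or.inr rfl) hlink.left_notMem
  · rcases (hN.adj_iff w).1 hw with rfl | rfl | rfl
    exacts [absurd (Or.inr rfl) hlink.right_notMem, absurd rfl hvw, hlink]
  · rcases (hN.adj_iff w).1 hw with rfl | rfl | rfl
    exacts [absurd (Or.inr rfl) hlink.right_notMem, hlink.symm, absurd rfl hvw]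

omit [Fintype V] in
/-- A shortest cycle passing through both ends of an edge. -/
theorem SimpleGraph.Walk.IsCycle.exists_isPath_of_adj {C : G.Walk u u} (hC : C.IsCycle)
    (hg : GirthGE G (k + 4)) (hl : C.length = k + 4) (hxy : G.Adj x y) (hx : x ∈ C.support)
    (hy : y ∈ C.support) : ∃ (v w : V) (P : G.Walk v w), P.IsPath ∧ P.length = k + 1 ∧
      G.Adj x w ∧ w ≠ y ∧ G.Adj y v ∧ v ≠ x ∧ x ∉ P.support ∧ y ∉ P.support ∧
      C.support.toFinset = insert x (insert y P.support.toFinset) := by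
  obtain ⟨v, w, P, hP, hv, hw, hvw, hxP, hlen, -, hs⟩ := hC.exists_isPath hx
  have hyP : y ∈ P.support := ((hs y).1 hy).resolve_left hxy.ne'
  have main (w) (hw : G.Adj x w) (P : G.Walk y w) (hP : P.IsPath) (hyw : y ≠ w)
      (hxP : x ∉ P.support) (hlen : P.length + 2 = C.length)
      (hs : ∀ z, z ∈ C.support ↔ z = x ∨ z ∈ P.support) :
      ∃ (v w : V) (P : G.Walk v w), P.IsPath ∧ P.length = k + 1 ∧
      G.Adj x w ∧ w ≠ y ∧ G.Adj y v ∧ v ≠ x ∧ x ∉ P.support ∧ y ∉ P.support ∧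
      C.support.toFinset = insert x (insert y P.support.toFinset) := by
    cases P with
    | nil => exact absurd rfl hyw
    | @cons _ v _ hyv P =>
      rw [Walk.cons_isPath_iff] at hP
      simp only [Walk.support_cons, List.mem_cons, not_or] at hxP
      refine ⟨v, w, P, hP.1, by simp at hlen; omega, hw, hyw.symm, hyv, ?_, hxP.2, hP.2, ?_⟩
      · rintro rfl; exact hxP.2 P.start_mem_support
      · ext z; simpa using hs z
  by_cases hyv : v = y
  · subst hyv
    exact main w hw P hP hvw hxP hlen hs
  by_cases hyw : w = y
  · subst hyw
    exact main v hv P.reverse hP.reverse hvw.symm (by simpa using hxP) (by simpa using hlen)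
      (by simpa using hs)
  · have h1 := P.take_spec hyP
    have h2 : (P.takeUntil y hyP).length + (P.dropUntil y hyP).length = P.length := by
      rw [← Walk.length_append, h1]
    have := hg.le_of_link (S := {x}) (n := (P.takeUntil y hyP).length) hv hxy hyv
      ⟨_, le_rfl, fun z hz hzx => hxP (hzx ▸ P.support_takeUntil_subset_support hyP hz)⟩ rfl
    have := hg.le_of_link (S := {x}) (n := (P.dropUntil y hyP).length) hxy hw (Ne.symm hyw)
      ⟨_, le_rfl, fun z hz hzx => hxP (hzx ▸ P.support_dropUntil_subset_support hyP hz)⟩ rfl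
    omega

omit [Fintype V] in
theorem mem_cycleSets_of_isPath {P : G.Walk p q} (hP : P.IsPath) (hl : P.length = k + 1)
    (hxy : G.Adj x y) (hx : G.Adj x q) (hy : G.Adj y p) (hqy : q ≠ y) (hxP : x ∉ P.support)
    (hyP : y ∉ P.support) : insert x (insert y P.support.toFinset) ∈ cycleSets G k := by
  have hQ : (Walk.cons hy P).IsPath := by
    rw [Walk.cons_isPath_iff]; exact ⟨hP, hyP⟩
  refine ⟨x, _, hQ.isCycle_cons_concat hxy hx.symm hqy.symm ?_, ?_, ?_⟩
  · simp [hxP, hxy.ne]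
  · simp [hl]
  · ext z
    simp only [Walk.support_cons, Walk.support_concat, List.mem_toFinset, Finset.mem_insert,
      List.mem_cons, List.mem_append]
    grind

theorem Mate.exists_link_aux (h : Mate k G H) (hag : AgreeOff G H {x, y}) (hx : Nbrs G x y p q)
    (hy : Nbrs G y x r s) (hx' : Nbrs H x y p r) (hy' : Nbrs H y x q s)
    (hl : Link H {x, y} (k + 2) p r) :
    Link G {x, y} (k + 2) p q ∨ Link G {x, y} (k + 2) r s := by
  by_contra! hno
  have hsub : cycleSets G k ⊆ cycleSets H k := by
    rintro _ ⟨u, C, hC, hCl, rfl⟩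
    by_cases hxC : x ∈ C.support
    · by_cases hyC : y ∈ C.support
      · obtain ⟨v, w, P, hP, hPl, hw, hwy, hv, hvx, hxP, hyP, hs⟩ :=
          hC.exists_isPath_of_adj h.girth_left hCl hx.adj₁ hxC hyC
        rw [hs]
        have hPH : ∀ e ∈ P.edges, e ∈ H.edgeSet := by
          intro e he
          induction e with
          | _ a b =>
            have ha := P.fst_mem_support_of_mem_edges he
            have hb := P.snd_mem_support_of_mem_edges he
            refine (hag a b ?_ ?_).1 (P.adj_of_mem_edges he)
            · rintro (rfl | rfl) <;> tauto
            · rintro (rfl | rfl) <;> tauto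
        have hmem := mem_cycleSets_of_isPath (P := P.transfer H hPH) (hP.transfer hPH)
          (by simpa using hPl) hx'.adj₁
        have hmem' := mem_cycleSets_of_isPath (P := (P.transfer H hPH).reverse)
          (hP.transfer hPH).reverse (by simpa using hPl) hx'.adj₁
        have hlH : Link H {x, y} (k + 1) v w := by
          refine ⟨P.transfer H hPH, by simp [hPl], fun z hz => ?_⟩
          rw [Walk.support_transfer] at hz
          rintro (rfl | rfl) <;> tauto
        simp only [Walk.support_transfer, Walk.support_reverse, List.toFinset_reverse,
          List.mem_reverse] at hmem hmem'
        rcases (hx.adj_iff w).1 hw with rfl | rfl | rfl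
        · exact absurd rfl hwy
        · rcases (hy.adj_iff v).1 hv with rfl | rfl | rfl
          · exact absurd rfl hvx
          · have := h.girth_right.le_of_link hx'.adj₃ hx'.adj₂ hx'.ne₂₃.symm hlH (by simp)
            omega
          · exact hmem hx'.adj₂ hy'.adj₃ hwy hxP hyP
        · rcases (hy.adj_iff v).1 hv with rfl | rfl | rfl
          · exact absurd rfl hvx
          · exact hmem' hx'.adj₃ hy'.adj₂ hx'.ne₁₃.symm hxP hyP
          · have := h.girth_right.le_of_link hy'.adj₃ hy'.adj₂ hy'.ne₂₃.symm hlH (by simp)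
            omega
      · exact (hno.1 (hC.link hCl hx hxC hyC)).elim
    · by_cases hyC : y ∈ C.support
      · have := hC.link hCl hy hyC hxC
        rw [Set.pair_comm] at this
        exact (hno.2 this).elim
      · have hCH : ∀ e ∈ C.edges, e ∈ H.edgeSet := by
          intro e he
          induction e with
          | _ a b =>
            have ha := C.fst_mem_support_of_mem_edges he
            have hb := C.snd_mem_support_of_mem_edges he
            refine (hag a b ?_ ?_).1 (C.adj_of_mem_edges he)
            · rintro (rfl | rfl) <;> tauto
            · rintro (rfl | rfl) <;> tauto
        exact ⟨u, C.transfer H hCH, hC.transfer hCH, by simpa using hCl, by simp⟩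
  obtain ⟨P, hP, hPl, hPS⟩ := hl.exists_isPath
  have hxP : x ∉ P.support := fun hx => hPS x hx (by simp)
  have hyP : y ∉ P.support := fun hy => hPS y hy (by simp)
  have hD := hP.isCycle_cons_concat hx'.adj₂ hx'.adj₃.symm hx'.ne₂₃ hxP
  set D := Walk.cons hx'.adj₂ (P.concat hx'.adj₃.symm) with hDdef
  have hDl : D.length = k + 4 := by
    have h1 := h.girth_right _ D hD
    have h2 : D.length = P.length + 2 := by simp [hDdef]
    omega
  have hDs (z) : z ∈ D.support ↔ z = x ∨ z ∈ P.support := by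
    simp [hDdef, Walk.support_concat]; tauto
  have hT : D.support.toFinset ∈ cycleSets G k := by
    rw [h.cycleSets_eq_of_subset hsub]
    exact ⟨_, D, hD, hDl, rfl⟩
  obtain ⟨u, C, hC, hCl, hCs⟩ := hT
  have hCs' (z) : z ∈ C.support ↔ z = x ∨ z ∈ P.support := by
    rw [← hDs, ← List.mem_toFinset, hCs, List.mem_toFinset]
  exact hno.1 (hC.link hCl hx ((hCs' x).2 (Or.inl rfl)) fun hy => (hCs' y).1 hy |>.elim
    hx.adj₁.ne' hyP)

/-- If exchanging neighbours of two adjacent vertices creates a shortest cycle, then it also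
destroys one. -/
theorem Mate.exists_link (h : Mate k G H) (hag : AgreeOff G H {x, y}) (hx : Nbrs G x y p q)
    (hy : Nbrs G y x r s) (hx' : Nbrs H x y p r) (hy' : Nbrs H y x q s)
    (hl : Link H {x, y} (k + 2) p r ∨ Link H {x, y} (k + 2) q s) :
    Link G {x, y} (k + 2) p q ∨ Link G {x, y} (k + 2) r s := by
  rcases hl with hl | hl
  · exact h.exists_link_aux hag hx hy hx' hy' hl
  · rw [Set.pair_comm] at hag hl ⊢
    exact ((h.exists_link_aux hag hy.swap₂₃ hx.swap₂₃ hy'.swap₂₃ hx'.swap₂₃ hl.symm).imp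
      Link.symm Link.symm).symm

end Exchange

/-! ### Pairs of short cycles sharing consecutive edges -/

section Splice

variable {V : Type*} [Fintype V] [DecidableEq V] {G H H' : SimpleGraph V} {k : ℕ}
  {v₀ v₁ v₂ v₃ v₄ w a b c d a₁ a₂ c₁ c₂ A C E F d' : V}

/-- Two short cycles sharing three consecutive edges also share the preceding edge. -/
theorem Mate.arc_left_unique (h : Mate k G H) (h₁ : Arc G (k + 1) v₀ v₁ v₂ v₃ v₄)
    (h₂ : Arc G (k + 1) w v₁ v₂ v₃ v₄) : v₀ = w := by
  by_contra hne
  have hN₁ := h.cubic_left.nbrs h₁.adj₁₂ h₁.adj₀₁.symm h₂.adj₀₁.symm h₁.ne₀₂.symm h₂.ne₀₂.symm hne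
  obtain ⟨z, hN₃⟩ := h.cubic_left.exists_nbrs₂ h₁.adj₂₃.symm h₁.adj₃₄ h₁.ne₂₄
  obtain ⟨H', hm, hag, h' | h'⟩ := h.exists_switch h₁.ne₁₃ hN₁ hN₃ (Or.inr rfl)
  · have := hm.girth_right.le_of_link h'.1.adj₂ h'.1.adj₃ h'.1.ne₂₃
      (h₁.link.of_agreeOff hag (by intro; simp; tauto)) (by simp)
    omega
  · have := hm.girth_right.le_of_link h'.2.adj₂ h'.2.adj₃ h'.2.ne₂₃
      (h₂.link.of_agreeOff hag (by intro; simp; tauto)) (by simp)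
    omega

theorem Mate.arc_right_unique (h : Mate k G H) (h₁ : Arc G (k + 1) v₀ v₁ v₂ v₃ v₄)
    (h₂ : Arc G (k + 1) v₀ v₁ v₂ v₃ w) : v₄ = w :=
  h.arc_left_unique h₁.symm h₂.symm

/-- Two shortest cycles do not share two consecutive edges. -/
theorem Mate.shortest_arc_unique (h : Mate k G H) (h₁ : Arc G k v₀ v₁ v₂ v₃ v₄)
    (h₂ : Arc G k a v₁ v₂ v₃ c) : v₀ = a := by
  by_contra hne
  have hN₁ := h.cubic_left.nbrs h₁.adj₁₂ h₁.adj₀₁.symm h₂.adj₀₁.symm h₁.ne₀₂.symm h₂.ne₀₂.symm hne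
  obtain ⟨z, hN₂⟩ := h.cubic_left.exists_nbrs₂ h₁.adj₁₂.symm h₁.adj₂₃ h₁.ne₁₃
  obtain ⟨H', hm, hag, h' | h'⟩ := h.exists_switch h₁.adj₁₂.ne hN₁ hN₂ (Or.inl ⟨rfl, rfl⟩)
  · have := hm.girth_right.le_of_link h'.1.adj₂ h'.1.adj₃ h'.1.ne₂₃
      (h₁.link₀₃.of_agreeOff hag subset_rfl) (by simp)
    omega
  · have := hm.girth_right.le_of_link h'.2.adj₃ h'.2.adj₂ h'.2.ne₂₃.symm
      (h₂.link₀₃.symm.of_agreeOff hag subset_rfl) (by simp)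
    omega

/-- Three short cycles through the three paths at `b` which agree at `a` and at `c` also agree
at `d`. -/
theorem Mate.arc_triple (h : Mate k G H) (hb : Nbrs G b a c d) (h₁ : Arc G (k + 1) A a b c C)
    (h₂ : Arc G (k + 1) E d b c C) (h₃ : Arc G (k + 1) A a b d F) : E = F := by
  by_contra hne
  obtain ⟨z, hNa⟩ := h.cubic_left.exists_nbrs₂ h₁.adj₁₂ h₁.adj₀₁.symm h₁.ne₀₂.symm
  have hNd := h.cubic_left.nbrs h₂.adj₁₂ h₃.adj₃₄ h₂.adj₀₁.symm h₃.ne₂₄ h₂.ne₀₂.symm (Ne.symm hne)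
  obtain ⟨H', hm, hag, h' | h'⟩ := h.exists_switch hb.ne₁₃ hNa hNd (Or.inr rfl)
  · have := hm.girth_right.le_of_link h'.1.adj₂ h'.1.adj₃ h'.1.ne₂₃
      (h₃.link.of_agreeOff hag (by intro; simp; tauto)) (by simp)
    omega
  · have hbc : H'.Adj b c :=
      (hag b c (by simpa using ⟨hb.adj₁.ne, hb.adj₃.ne⟩)
        (by simpa using ⟨hb.ne₁₂.symm, hb.ne₂₃⟩)).1 hb.adj₂
    have hcC : H'.Adj c C :=
      (hag c C (by simpa using ⟨hb.ne₁₂.symm, hb.ne₂₃⟩)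
        (by simpa using ⟨h₁.ne₁₄.symm, h₂.ne₁₄.symm⟩)).1 h₁.adj₃₄
    have hA : Arc H' (k + 1) A a b c C :=
      ⟨h'.1.adj₂.symm, h'.1.adj₁, hbc, hcC, hb.ne₁₂,
        ((h₁.link_insert h.girth_left le_rfl hb.adj₃ hb.ne₁₃.symm hb.ne₂₃.symm).of_agreeOff hag
          (by intro; simp; tauto)).mono (by intro; simp; tauto) le_rfl⟩
    have hE : Arc H' (k + 1) E a b c C :=
      ⟨h'.1.adj₃.symm, h'.1.adj₁, hbc, hcC, hb.ne₁₂,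
        ((h₂.link_insert h.girth_left le_rfl hb.adj₁ hb.ne₁₃ hb.ne₁₂).of_agreeOff hag
          (by intro; simp; tauto)).mono (by intro; simp; tauto) le_rfl⟩
    exact h'.1.ne₂₃ (hm.symm.arc_left_unique hA hE)

/-- The short cycle produced at one end of two spliced short cycles. -/
def EndCycle (G : SimpleGraph V) (k : ℕ) (a₁ a₂ a b c d : V) : Prop :=
  ∃ t v, Arc G k t a₁ a a₂ v ∧ ¬ Arc G (k + 1) t a₁ a b c ∧ ¬ Arc G (k + 1) v a₂ a b d

theorem Mate.endCycle_of_switch (h : Mate k G H) (hb : Nbrs G b a c d)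
    (hC : Arc G (k + 1) a₁ a b c c₁) (hD : Arc G (k + 1) a₂ a b c c₂) (hne : a₁ ≠ a₂)
    (hm : Mate k G H') (hag : AgreeOff G H' {a, b}) (ha' : Nbrs H' a b a₁ d)
    (hb' : Nbrs H' b a a₂ c) :
    (∃ d', Arc G k d' d b c c₂) ∨ EndCycle G k a₁ a₂ a b c d := by
  have hNa := h.cubic_left.nbrs hC.adj₁₂ hC.adj₀₁.symm hD.adj₀₁.symm hC.ne₀₂.symm hD.ne₀₂.symm hne
  have hl : Link H' {a, b} (k + 2) a₂ c := hD.link₀₃.of_agreeOff hag subset_rfl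
  have hcab : c ∉ ({a, b} : Set V) := hC.link₀₃.right_notMem
  rcases hm.exists_link hag hNa hb.swap₂₃ ha' hb' (Or.inr hl) with hl' | hl'
  · right
    obtain ⟨t, v, hE⟩ := (hl'.mono (T := {a}) (by simp) le_rfl).exists_arc h.girth_five hNa.adj₂
      hNa.adj₃ hne rfl
    have hEl := hE.link_insert h.girth_left (Nat.le_succ k) hNa.adj₁ hNa.ne₁₂ hNa.ne₁₃
    have htb : t ∉ ({a, b} : Set V) := fun ht => hEl.left_notMem (by simp at ht ⊢; tauto)
    have hvb : v ∉ ({a, b} : Set V) := fun hv => hEl.right_notMem (by simp at hv ⊢; tauto)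
    have h₁b : a₁ ∉ ({a, b} : Set V) := by simpa using ⟨hNa.adj₂.ne', hNa.ne₁₂.symm⟩
    have h₂b : a₂ ∉ ({a, b} : Set V) := by simpa using ⟨hNa.adj₃.ne', hNa.ne₁₃.symm⟩
    have hta : H'.Adj t a₁ := (hag _ _ htb h₁b).1 hE.adj₀₁
    have hva : H'.Adj v a₂ := (hag _ _ hvb h₂b).1 hE.adj₃₄.symm
    have hElH : Link H' {a₁, a, a₂, b} k t v := hEl.of_agreeOff hag (by intro; simp; tauto)
    refine ⟨t, v, hE, fun hX => ?_, fun hX => ?_⟩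
    · have hX' : Arc H' (k + 1) t a₁ a b c :=
        ⟨hta, ha'.adj₂.symm, ha'.adj₁, hb'.adj₃, hX.ne₁₃,
          hX.link.of_agreeOff hag (by intro; simp; tauto)⟩
      have hX'' : Arc H' (k + 1) t a₁ a b a₂ :=
        ⟨hta, ha'.adj₂.symm, ha'.adj₁, hb'.adj₂, hX.ne₁₃,
          (hElH.mono (by intro; simp; tauto) le_rfl).snoc hva
            (by simpa using ⟨hne.symm, hNa.adj₃.ne', hNa.ne₁₃.symm⟩)⟩
      exact hb'.ne₂₃ (hm.symm.arc_right_unique hX'' hX')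
    · have hX' : Arc H' (k + 1) v a₂ b a d :=
        ⟨hva, hb'.adj₂.symm, hb'.adj₁, ha'.adj₃, hE.adj₂₃.ne',
          hX.link.of_agreeOff hag (by intro; simp; tauto) |>.mono (by intro; simp; tauto) le_rfl⟩
      have hX'' : Arc H' (k + 1) v a₂ b a a₁ :=
        ⟨hva, hb'.adj₂.symm, hb'.adj₁, ha'.adj₂, hE.adj₂₃.ne',
          (hElH.symm.mono (by intro; simp; tauto) le_rfl).snoc hta
            (by simpa using ⟨hne, hNa.ne₁₂.symm, hNa.adj₂.ne'⟩)⟩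
      exact ha'.ne₂₃ (hm.symm.arc_right_unique hX'' hX')
  · left
    have hc₁₂ : c₁ ≠ c₂ := by
      rintro rfl; exact hne (h.arc_left_unique hC hD)
    have hNc := h.cubic_left.nbrs hC.adj₂₃.symm hC.adj₃₄ hD.adj₃₄ hC.ne₂₄ hD.ne₂₄ hc₁₂
    obtain ⟨m, c', hm', hcc', hl''⟩ := hl'.symm.step hb.ne₂₃
    obtain rfl : k + 1 = m := by omega
    rcases (hNc.adj_iff c').1 hcc' with rfl | rfl | rfl
    · exact absurd (by simp) hl''.left_notMem
    · have hcc₁ : H'.Adj c c' :=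
        (hag _ _ hcab fun h => hl''.left_notMem (Or.inr h)).1 hC.adj₃₄
      have h₁ : Arc H' (k + 1) d a b c c' :=
        ⟨ha'.adj₃.symm, ha'.adj₁, hb'.adj₃, hcc₁, hC.ne₁₃,
          (hl''.symm.of_agreeOff hag (by simp)).mono (by intro; simp; tauto) le_rfl⟩
      have h₂ : Arc H' (k + 1) a₁ a b c c' :=
        ⟨ha'.adj₂.symm, ha'.adj₁, hb'.adj₃, hcc₁, hC.ne₁₃,
          hC.link.of_agreeOff hag (by intro; simp; tauto)⟩
      exact (ha'.ne₂₃ (hm.symm.arc_left_unique h₂ h₁)).elim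
    · refine hl''.symm.exists_arc_left ?_ hb.adj₃.symm hb.adj₂ hD.adj₃₄ hb.ne₂₃.symm (by simp)
        (by simp)
      rintro rfl
      exact h.1.no_triangle hb.adj₃ hD.adj₃₄.symm hD.adj₂₃.symm

/-- The alternatives when a shortest cycle is spliced with a short cycle. -/
theorem Mate.endCycle (h : Mate k G H) (hb : Nbrs G b a c d) (hC : Arc G k a₁ a b c c₁)
    (hD : Arc G (k + 1) a₂ a b c c₂) (hne : a₁ ≠ a₂) :
    (∃ d', Arc G k d' d b c c₂) ∨ EndCycle G k a₁ a₂ a b c d := by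
  have hNa := h.cubic_left.nbrs hC.adj₁₂ hC.adj₀₁.symm hD.adj₀₁.symm hC.ne₀₂.symm hD.ne₀₂.symm hne
  obtain ⟨H', hm, hag, h' | h'⟩ := h.exists_switch hC.adj₁₂.ne hNa hb.swap₂₃ (Or.inl ⟨rfl, rfl⟩)
  · exact h.endCycle_of_switch hb (hC.mono (Nat.le_succ k)) hD hne hm hag h'.1 h'.2
  · have := hm.girth_right.le_of_link h'.1.adj₂ h'.1.adj₃ h'.1.ne₂₃
      (hC.link₀₃.of_agreeOff hag subset_rfl) (by simp)
    omega

theorem Mate.not_arc_third (h : Mate k G H) (hb : Nbrs G b a c d) (hC : Arc G k a₁ a b c c₁)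
    (hD : Arc G (k + 1) a₂ a b c c₂) (hne : a₁ ≠ a₂) : ¬ Arc G k d' d b c c₂ := by
  intro hE
  have hg := h.girth_five
  have hC1 := hC.mono (Nat.le_succ k)
  have hc : c₁ ≠ c₂ := by
    rintro rfl; exact hne (h.arc_left_unique hC1 hD)
  rcases h.endCycle hb.swap₁₂ hC.symm hD.symm hc with ⟨d'', hF⟩ | ⟨t, v, hF, hF₁, hF₂⟩
  · obtain rfl := h.arc_triple hb hD (hE.mono (Nat.le_succ k)) (hF.symm.mono (Nat.le_succ k))
    obtain ⟨s, hs⟩ := hE.shift hg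
    obtain ⟨s', hs'⟩ := hF.shift hg
    exact hb.ne₁₂ (h.shortest_arc_unique hs.symm hs'.symm).symm
  · obtain ⟨r, hr⟩ := hE.unshift hg
    obtain ⟨s, hs⟩ := hD.unshift hg
    obtain ⟨p, hp⟩ := hC1.unshift hg
    have hr1 := hr.mono (Nat.le_succ k)
    have hvr : r ≠ v := by
      rintro rfl; exact hF₂ hr1.symm
    have hrs : r ≠ s := by
      rintro rfl; exact hb.ne₁₃ (h.arc_left_unique hs hr1)
    have hN := h.cubic_left.nbrs hD.adj₃₄.symm hr.adj₃₄ hs.adj₃₄ hr.ne₂₄ hs.ne₂₄ hrs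
    have hNc := h.cubic_left.nbrs hC.adj₂₃.symm hD.adj₃₄ hC.adj₃₄ hD.ne₂₄ hC.ne₂₄ hc.symm
    rcases (hN.adj_iff v).1 hF.adj₃₄ with rfl | rfl | rfl
    · exact hF.ne₂₄ rfl
    · exact hvr rfl
    · obtain rfl := h.arc_triple hNc hs (hF.mono (Nat.le_succ k)) hp
      exact hF₁ hp.symm

/-- Auxiliary step for `Mate.not_shortest_spliced`: there is no short cycle through the third
neighbour `d` of `b`. -/
theorem Mate.not_arc_turn (h : Mate k G H) (hb : Nbrs G b a c d) (hC : Arc G k a₁ a b c c₁)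
    (hD : Arc G (k + 1) a₂ a b c c₂) (hne : a₁ ≠ a₂) : ¬ Arc G (k + 1) w a b d d' := by
  intro hJ
  have hg := h.girth_five
  have hC1 := hC.mono (Nat.le_succ k)
  have hNa := h.cubic_left.nbrs hC.adj₁₂ hC.adj₀₁.symm hD.adj₀₁.symm hC.ne₀₂.symm hD.ne₀₂.symm hne
  rcases h.endCycle hb hC hD hne with ⟨_, hE⟩ | ⟨t, v, hE, hE₁, hE₂⟩
  · exact h.not_arc_third hb hC hD hne hE
  obtain ⟨s₁, hs₁⟩ := hC.shift hg
  obtain ⟨s₂, hs₂⟩ := hD.shift hg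
  have hs₁' := hs₁.mono (Nat.le_succ k)
  obtain ⟨u, hu⟩ := hJ.shift hg
  have hts : s₁ ≠ t := by
    rintro rfl; exact hE₁ hs₁'
  rcases (hNa.adj_iff w).1 hJ.adj₀₁.symm with rfl | rfl | rfl
  · exact hJ.ne₀₂ rfl
  · have hsu : s₁ ≠ u := by
      rintro rfl; exact hb.ne₂₃ (h.arc_right_unique hs₁' hu)
    have hN := h.cubic_left.nbrs hC.adj₀₁ hs₁.adj₀₁.symm hE.adj₀₁.symm hs₁.ne₀₂.symm hE.ne₀₂.symm
      hts
    rcases (hN.adj_iff u).1 hu.adj₀₁.symm with rfl | rfl | rfl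
    · exact hu.ne₀₂ rfl
    · exact hsu rfl
    · obtain ⟨τ, hτ⟩ := hE.shift hg
      obtain ⟨υ, hυ⟩ := hu.shift hg
      obtain ⟨s₀, hs₀⟩ := hs₁.shift hg
      refine h.not_arc_third hN.swap₂₃.swap₁₂ hτ hυ ?_ hs₀
      rintro rfl
      exact hNa.ne₁₃ (h.arc_right_unique hυ (hτ.mono (Nat.le_succ k)))
  · have hvu : u ≠ v := by
      rintro rfl; exact hE₂ hu
    have hsu : s₂ ≠ u := by
      rintro rfl; exact hb.ne₂₃ (h.arc_right_unique hs₂ hu)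
    have hsv : s₂ ≠ v := by
      rintro rfl
      exact hts (h.arc_triple hNa.swap₂₃ hs₂.symm (hE.mono (Nat.le_succ k)) hs₁'.symm).symm
    have hN := h.cubic_left.nbrs hD.adj₀₁ hs₂.adj₀₁.symm hE.adj₃₄ hs₂.ne₀₂.symm hE.ne₂₄ hsv
    rcases (hN.adj_iff u).1 hu.adj₀₁.symm with rfl | rfl | rfl
    · exact hu.ne₀₂ rfl
    · exact hsu rfl
    · exact hvu rfl

/-- A shortest cycle is never spliced with another short cycle. -/
theorem Mate.not_shortest_spliced (h : Mate k G H) (hC : Arc G k a₁ a b c c₁)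
    (hD : Arc G (k + 1) a₂ a b c c₂) : a₁ = a₂ := by
  by_contra hne
  have hC1 := hC.mono (Nat.le_succ k)
  have hc : c₁ ≠ c₂ := by
    rintro rfl; exact hne (h.arc_left_unique hC1 hD)
  obtain ⟨d, hb⟩ := h.cubic_left.exists_nbrs₂ hC.adj₁₂.symm hC.adj₂₃ hC.ne₁₃
  obtain ⟨d₁, d₂, hd⟩ := h.cubic_left.exists_nbrs₁ hb.adj₃.symm
  have hl := hC.link_nbrs_insert h.girth_left (Nat.le_succ k) hb.adj₃ hb.ne₁₃.symm hb.ne₂₃.symm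
  have key (d₁ d₂ : V) (hd : Nbrs G d b d₁ d₂) (H' : SimpleGraph V) (hm : Mate k G H')
      (hag : AgreeOff G H' {b, d}) (h₁ : Nbrs H' b d a d₁) (h₂ : Nbrs H' d b c d₂) : False := by
    rcases hm.symm.exists_link hag.symm h₁ h₂ hb.swap₂₃.swap₁₂ hd (Or.inl hl) with hl' | hl'
    · obtain ⟨w, hw⟩ := (hl'.of_agreeOff hag.symm subset_rfl).exists_arc_left (by
        rintro rfl; exact h.1.no_triangle hb.adj₁ hd.adj₂.symm hb.adj₃.symm) hb.adj₁.symm hb.adj₃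
          hd.adj₂ hb.ne₁₃ (by simp) (by simp)
      exact h.not_arc_turn hb hC hD hne hw
    · obtain ⟨w, hw⟩ := (hl'.of_agreeOff hag.symm subset_rfl).exists_arc_left (by
        rintro rfl; exact h.1.no_triangle hb.adj₂ hd.adj₃.symm hb.adj₃.symm) hb.adj₂.symm hb.adj₃
          hd.adj₃ hb.ne₂₃ (by simp) (by simp)
      exact h.not_arc_turn hb.swap₁₂ hC.symm hD.symm hc hw
  obtain ⟨H', hm, hag, h' | h'⟩ := h.exists_switch hb.adj₃.ne hb.swap₂₃.swap₁₂ hd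
    (Or.inl ⟨rfl, rfl⟩)
  · exact key d₁ d₂ hd H' hm hag h'.1 h'.2
  · exact key d₂ d₁ hd.swap₂₃ H' hm hag h'.1 h'.2

end Splice

section NotSpliced

variable {V : Type*} [Fintype V] [DecidableEq V] {G H H' : SimpleGraph V} {k : ℕ}
  {a b c d a₁ a₂ c₁ c₂ t v x y p q r s : V}

omit [Fintype V] [DecidableEq V] in
theorem Nbrs.comap (h : Nbrs G v a b c) (σ : Equiv.Perm V) :
    Nbrs (G.comap σ) (σ.symm v) (σ.symm a) (σ.symm b) (σ.symm c) :=
  ⟨fun w => by simp [h.adj_iff, Equiv.eq_symm_apply], by simpa using h.ne₁₂,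
    by simpa using h.ne₁₃, by simpa using h.ne₂₃⟩

/-- A switch at the two ends of an edge `xy`, with one of the neighbours of `y` prescribed
to be kept. -/
theorem Mate.exists_switch_edge (h : Mate k G H) (hx : Nbrs G x y p q) (hy : Nbrs G y x r s) :
    ∃ H', Mate k G H' ∧ AgreeOff G H' {x, y} ∧
      (Nbrs H' x y p r ∧ Nbrs H' y x q s ∨ Nbrs H' x y q r ∧ Nbrs H' y x p s) := by
  have hxy : x ≠ y := hx.adj₁.ne
  obtain ⟨H', hm, hag, h' | h'⟩ := h.exists_switch hxy hx hy (Or.inl ⟨rfl, rfl⟩)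
  · exact ⟨H', hm, hag, Or.inl h'⟩
  let σ := Equiv.swap x y
  refine ⟨H'.comap σ, hm.congr_right (Iso.comap σ H').symm, fun u v hu hv => ?_, Or.inr ⟨?_, ?_⟩⟩
  · simp only [Set.mem_insert_iff, Set.mem_singleton_iff, not_or] at hu hv
    rw [comap_adj, Equiv.swap_apply_of_ne_of_ne hu.1 hu.2, Equiv.swap_apply_of_ne_of_ne hv.1 hv.2]
    exact hag u v (by simpa using hu) (by simpa using hv)
  · simpa [σ, Equiv.swap_apply_of_ne_of_ne h'.2.ne₁₂.symm h'.2.adj₂.ne',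
      Equiv.swap_apply_of_ne_of_ne h'.2.ne₁₃.symm h'.2.adj₃.ne'] using h'.2.comap σ
  · simpa [σ, Equiv.swap_apply_of_ne_of_ne h'.1.adj₂.ne' h'.1.ne₁₂.symm,
      Equiv.swap_apply_of_ne_of_ne h'.1.adj₃.ne' h'.1.ne₁₃.symm] using h'.1.comap σ

/-- If two short cycles both pass through `b` via `a` and `c`, then after the switch at `ab` only
the second alternative of `Mate.endCycle_of_switch` is possible. -/
theorem Mate.endCycle_of_switch' (h : Mate k G H) (hb : Nbrs G b a c d)
    (hC : Arc G (k + 1) a₁ a b c c₁) (hD : Arc G (k + 1) a₂ a b c c₂) (hne : a₁ ≠ a₂)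
    (hm : Mate k G H') (hag : AgreeOff G H' {a, b}) (ha' : Nbrs H' a b a₁ d)
    (hb' : Nbrs H' b a a₂ c) : EndCycle G k a₁ a₂ a b c d := by
  refine (h.endCycle_of_switch hb hC hD hne hm hag ha' hb').resolve_left ?_
  rintro ⟨d', hA⟩
  obtain ⟨r, hr⟩ := hA.unshift h.girth_five
  obtain ⟨s, hs⟩ := hD.unshift h.girth_five
  exact hb.ne₁₃ (h.not_shortest_spliced hr hs).symm

theorem Mate.exists_arc_of_spliced (h : Mate k G H)
    (hC : Arc G (k + 1) a₁ a b c c₁) (hD : Arc G (k + 1) a₂ a b c c₂) (hne : a₁ ≠ a₂) :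
    ∃ t v, Arc G k t a₁ a a₂ v := by
  have hNa := h.cubic_left.nbrs hC.adj₁₂ hC.adj₀₁.symm hD.adj₀₁.symm hC.ne₀₂.symm hD.ne₀₂.symm hne
  obtain ⟨d, hb⟩ := h.cubic_left.exists_nbrs₂ hC.adj₁₂.symm hC.adj₂₃ hC.ne₁₃
  obtain ⟨H', hm, hag, h' | h'⟩ := h.exists_switch_edge hNa hb.swap₂₃
  · obtain ⟨t, v, hE, -⟩ := h.endCycle_of_switch' hb hC hD hne hm hag h'.1 h'.2
    exact ⟨t, v, hE⟩
  · obtain ⟨t, v, hE, -⟩ := h.endCycle_of_switch' hb hD hC (Ne.symm hne) hm hag h'.1 h'.2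
    exact ⟨v, t, hE.symm⟩

theorem Mate.false_of_switch (h : Mate k G H)
    (hC : Arc G (k + 1) a₁ a b c c₁) (hE : Arc G k t a₁ a a₂ v)
    (hE₁ : ¬ Arc G (k + 1) t a₁ a b c)
    (hm : Mate k G H') (hag : AgreeOff G H' {a, b}) (ha' : Nbrs H' a b a₁ d)
    (hb' : Nbrs H' b a a₂ c) (hNa : Nbrs G a b a₁ a₂) : False := by
  have hg := h.girth_five
  have hg' := hm.symm.girth_five
  obtain ⟨s, hs⟩ := hC.shift hg
  have hts : t ≠ s := by
    rintro rfl; exact hE₁ hs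
  have hN₁ := h.cubic_left.nbrs hE.adj₁₂ hs.adj₀₁.symm hE.adj₀₁.symm hs.ne₀₂.symm hE.ne₀₂.symm
    hts.symm
  have hEl := hE.link_insert h.girth_left (Nat.le_succ k) hNa.adj₁ hNa.ne₁₂ hNa.ne₁₃
  have htb : t ∉ ({a, b} : Set V) := fun ht => hEl.left_notMem (by simp at ht ⊢; tauto)
  have hvb : v ∉ ({a, b} : Set V) := fun hv => hEl.right_notMem (by simp at hv ⊢; tauto)
  have h₁b : a₁ ∉ ({a, b} : Set V) := by simpa using ⟨hNa.adj₂.ne', hNa.ne₁₂.symm⟩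
  have h₂b : a₂ ∉ ({a, b} : Set V) := by simpa using ⟨hNa.adj₃.ne', hNa.ne₁₃.symm⟩
  have hsb : s ∉ ({a, b} : Set V) := fun h' => hs.link.left_notMem (by simp at h' ⊢; tauto)
  have hta : H'.Adj t a₁ := (hag _ _ htb h₁b).1 hE.adj₀₁
  have hsa : H'.Adj s a₁ := (hag _ _ hsb h₁b).1 hs.adj₀₁
  have hva : H'.Adj v a₂ := (hag _ _ hvb h₂b).1 hE.adj₃₄.symm
  have hElH : Link H' {a₁, a, a₂, b} k t v := hEl.of_agreeOff hag (by intro; simp; tauto)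
  have hC' : Arc H' (k + 1) s a₁ a b c :=
    ⟨hsa, ha'.adj₂.symm, ha'.adj₁, hb'.adj₃, hs.ne₁₃,
      hs.link.of_agreeOff hag (by intro; simp; tauto)⟩
  have hE' : Arc H' (k + 1) t a₁ a b a₂ :=
    ⟨hta, ha'.adj₂.symm, ha'.adj₁, hb'.adj₂, hs.ne₁₃,
      (hElH.mono (by intro; simp; tauto) le_rfl).snoc hva
        (by simpa using ⟨hE.ne₁₃.symm, hNa.adj₃.ne', hNa.ne₁₃.symm⟩)⟩
  obtain ⟨m, m', hM⟩ := hm.symm.exists_arc_of_spliced hC' hE' hts.symm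
  have hl := hM.link_nbrs_insert hm.girth_right (Nat.le_succ k) ha'.adj₂.symm hC'.ne₀₂.symm
    hE'.ne₀₂.symm
  have hl' : Link H' {b, a₁, a} (k + 2) s t := by
    rcases hl.split b with hl | ⟨i, j, hij, hi, hj⟩
    · exact hl
    · have ha : a ∉ ({a₁} : Set V) := ha'.adj₂.ne
      have hi' := hm.girth_right.le_of_link hsa.symm ha'.adj₂.symm hC'.ne₀₂
        ((hi.mono (T := {a₁}) (by simp) le_rfl).snoc ha'.adj₁.symm ha) rfl
      have hj' := hm.girth_right.le_of_link hta.symm ha'.adj₂.symm hE'.ne₀₂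
        ((hj.symm.mono (T := {a₁}) (by simp) le_rfl).snoc ha'.adj₁.symm ha) rfl
      have := h.one_le
      omega
  have hlG : Link G {a, a₁} (k + 2) s t :=
    (hl'.of_agreeOff hag.symm (by intro; simp; tauto)).mono (by intro; simp; tauto) le_rfl
  obtain ⟨H₂, hm₂, hag₂, h' | h'⟩ := h.exists_switch hNa.adj₂.ne hNa.swap₁₂ hN₁
    (Or.inl ⟨rfl, rfl⟩)
  · have := hm₂.girth_right.le_of_link h'.2.adj₂ h'.2.adj₃ h'.2.ne₂₃
      ((hE.link₀₃.symm.mono (by intro; simp; tauto) le_rfl).of_agreeOff hag₂ subset_rfl) (by simp)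
    omega
  · rcases hm₂.symm.exists_link hag₂.symm h'.1 h'.2 hNa.swap₁₂ hN₁.swap₂₃ (Or.inr hlG.symm) with
      hl | hl
    · obtain ⟨τ, hτ⟩ := (hl.of_agreeOff hag₂.symm subset_rfl).symm.exists_arc_left (by
        rintro rfl; exact h.1.no_triangle hNa.adj₁ hE.adj₀₁ hNa.adj₂.symm) hE.adj₀₁ hE.adj₁₂
          hNa.adj₁ hE.ne₀₂ (by simp) (by simp)
      obtain ⟨τ', hτ'⟩ := hE.shift hg
      exact hNa.ne₁₃ (h.not_shortest_spliced hτ'.symm hτ.symm).symm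
    · obtain ⟨τ, hτ⟩ := (hl.of_agreeOff hag₂.symm subset_rfl).exists_arc_left (by
        rintro rfl; exact h.1.no_triangle hNa.adj₃ hs.adj₀₁ hNa.adj₂.symm) hNa.adj₃.symm
          hNa.adj₂ hs.adj₀₁.symm hNa.ne₂₃.symm (by simp) (by simp)
      exact hts (h.not_shortest_spliced hE hτ.symm)

/-- Two distinct short cycles are not spliced. -/
theorem Mate.not_spliced (h : Mate k G H) (hC : Arc G (k + 1) a₁ a b c c₁)
    (hD : Arc G (k + 1) a₂ a b c c₂) : a₁ = a₂ := by
  by_contra hne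
  have hNa := h.cubic_left.nbrs hC.adj₁₂ hC.adj₀₁.symm hD.adj₀₁.symm hC.ne₀₂.symm hD.ne₀₂.symm hne
  obtain ⟨d, hb⟩ := h.cubic_left.exists_nbrs₂ hC.adj₁₂.symm hC.adj₂₃ hC.ne₁₃
  obtain ⟨H', hm, hag, h' | h'⟩ := h.exists_switch_edge hNa hb.swap₂₃
  · obtain ⟨t, v, hE, hE₁, -⟩ := h.endCycle_of_switch' hb hC hD hne hm hag h'.1 h'.2
    exact h.false_of_switch hC hE hE₁ hm hag h'.1 h'.2 hNa
  · obtain ⟨t, v, hE, hE₁, -⟩ := h.endCycle_of_switch' hb hD hC (Ne.symm hne) hm hag h'.1 h'.2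
    exact h.false_of_switch hD hE hE₁ hm hag h'.1 h'.2 hNa.swap₂₃

end NotSpliced

section Final

variable {V : Type*} [Fintype V] [DecidableEq V] {G H : SimpleGraph V} {k : ℕ}
  {a b c s t u v x : V}

/-- Two short cycles which have three consecutive edges in common are equal. Here the cycles run
through `s`, `t`, `u`, `v`, then along `p` or `q` to `a`, and back along `r` to `s`. -/
theorem Mate.isPath_unique (h : Mate k G H) {p q : G.Walk v a} {r : G.Walk a s}
    (hst : G.Adj s t) (htu : G.Adj t u) (huv : G.Adj u v) (hp : p.IsPath) (hq : q.IsPath)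
    (htp : t ∉ p.support) (htq : t ∉ q.support) (hup : u ∉ p.support) (huq : u ∉ q.support)
    (htr : t ∉ r.support) (hur : u ∉ r.support)
    (hpr : ∀ z ∈ p.support, z ∈ r.support → z = a) (hqr : ∀ z ∈ q.support, z ∈ r.support → z = a)
    (hpl : p.length + r.length ≤ k + 2) (hql : q.length + r.length ≤ k + 2) : p = q := by
  induction p generalizing s t u with
  | nil => exact (Walk.eq_nil_iff_nil.2 (Walk.isPath_iff_nil.1 hq)).symm
  | @cons v x a hvx p ih =>
    cases q with
    | nil => exact absurd (Walk.isPath_iff_nil.1 hp) (by simp)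
    | @cons _ y _ hvy q =>
      rw [Walk.cons_isPath_iff] at hp hq
      simp only [Walk.support_cons, List.mem_cons, not_or, forall_eq_or_imp] at *
      simp only [Walk.length_cons] at hpl hql
      have hva : v ≠ a := by
        rintro rfl; exact hp.2 p.end_mem_support
      have hvr : v ∉ r.support := fun hv => hva (hpr.1 hv)
      have harc {x : V} (hvx : G.Adj v x) (p : G.Walk x a) (ht : t ∉ p.support)
          (hu : u ∉ p.support) (hv : v ∉ p.support) (hl : p.length + 1 + r.length ≤ k + 2) :
          Arc G (k + 1) s t u v x := by
        refine ⟨hst, htu, huv, hvx, htp.1, (p.append r).reverse, ?_, fun z hz => ?_⟩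
        · simp only [Walk.length_reverse, Walk.length_append]; omega
        · rw [Walk.support_reverse, List.mem_reverse, Walk.mem_support_append_iff] at hz
          rintro (rfl | rfl | rfl) <;> tauto
      obtain rfl := h.arc_right_unique (harc hvx p htp.2 hup.2 hp.2 hpl)
        (harc hvy q htq.2 huq.2 hq.2 hql)
      congr 1
      refine ih (r := r.concat hst) htu huv hvx hp.1 hq.1 hup.2 huq.2 hp.2 hq.2 ?_ ?_ ?_ ?_ ?_ ?_
      · simpa [Walk.support_concat] using ⟨hur, htu.ne'⟩
      · simpa [Walk.support_concat] using ⟨hvr, Ne.symm htp.1⟩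
      · intro z hz hzr
        rw [Walk.support_concat, List.mem_append, List.mem_singleton] at hzr
        rcases hzr with hzr | rfl
        exacts [hpr.2 z hz hzr, absurd hz htp.2]
      · intro z hz hzr
        rw [Walk.support_concat, List.mem_append, List.mem_singleton] at hzr
        rcases hzr with hzr | rfl
        exacts [hqr.2 z hz hzr, absurd hz htq.2]
      · simp only [Walk.length_concat]; omega
      · simp only [Walk.length_concat]; omega

theorem Mate.exists_arc_of_isPath (h : Mate k G H) (hcx : G.Adj c x) {p : G.Walk x a}
    (hab : G.Adj a b) (hbc : G.Adj b c) (hp : (Walk.cons hcx p).IsPath)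
    (hb : b ∉ (Walk.cons hcx p).support) (hl : (Walk.cons hcx p).length ≤ k + 3) :
    ∃ y, Arc G (k + 1) x c b a y := by
  have hxa : x ≠ a := by
    rintro rfl; exact h.1.no_triangle hab hbc hcx
  rw [Walk.cons_isPath_iff] at hp
  have hca : c ≠ a := by
    rintro rfl; exact hp.2 p.end_mem_support
  simp only [Walk.support_cons, List.mem_cons, not_or, Walk.length_cons] at hb hl
  obtain ⟨hp, hcp⟩ := hp
  have hb := hb.2
  rw [← p.reverse_reverse] at hp hb hcp hl
  generalize p.reverse = q at *
  cases q with
  | nil => exact absurd rfl hxa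
  | @cons _ y _ hay q =>
    simp only [Walk.isPath_reverse_iff, Walk.cons_isPath_iff, Walk.support_reverse,
      List.mem_reverse, Walk.support_cons, List.mem_cons, not_or, Walk.length_reverse,
      Walk.length_cons] at hp hb hcp hl
    refine ⟨y, hcx.symm, hbc.symm, hab.symm, hay, hca, q.reverse, ?_, fun z hz => ?_⟩
    · simp only [Walk.length_reverse]; omega
    · rw [Walk.support_reverse, List.mem_reverse] at hz
      rintro (rfl | rfl | rfl) <;> tauto

theorem Mate.isPath_unique_of_adj (h : Mate k G H) {p q : G.Walk c a}
    (hab : G.Adj a b) (hbc : G.Adj b c) (hac : a ≠ c) (hp : p.IsPath) (hq : q.IsPath)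
    (hbp : b ∉ p.support) (hbq : b ∉ q.support) (hpl : p.length ≤ k + 3)
    (hql : q.length ≤ k + 3) : p = q := by
  cases p with
  | nil => exact absurd rfl hac
  | @cons _ x _ hcx p =>
    cases q with
    | nil => exact absurd rfl hac
    | @cons _ y _ hcy q =>
      obtain ⟨s, hs⟩ := h.exists_arc_of_isPath hcx hab hbc hp hbp hpl
      obtain ⟨t, ht⟩ := h.exists_arc_of_isPath hcy hab hbc hq hbq hql
      obtain rfl := h.not_spliced hs ht
      rw [Walk.cons_isPath_iff] at hp hq
      simp only [Walk.support_cons, List.mem_cons, not_or, Walk.length_cons] at *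
      congr 1
      exact h.isPath_unique (r := .nil) hab hbc hcx hp.1 hq.1 hbp.2 hbq.2 hp.2 hq.2
        (by simpa using hab.ne') (by simpa using hac.symm) (by simp) (by simp)
        (by simp; omega) (by simp; omega)

omit [DecidableEq V] in
theorem SimpleGraph.IsRegularOfDegree.isCubic [DecidableRel G.Adj] (hG : G.IsRegularOfDegree 3) :
    IsCubic G := fun v => by
  rw [← hG v, ← card_neighborSet_eq_degree, Set.ncard_eq_toFinset_card', Set.toFinset_card]

theorem DeckPair.girth_five (h : DeckPair G H) : GirthGE G 5 := by
  intro u C hC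
  have h3 := hC.three_le_length
  by_contra! hlt
  match C, hC, hlt with
  | .cons h₁ (.cons h₂ (.cons h₃ .nil)), hC, _ => exact h.no_triangle h₁ h₂ h₃
  | .cons h₁ (.cons h₂ (.cons h₃ (.cons h₄ .nil))), hC, _ =>
    have := hC.support_nodup
    simp at this
    exact h.no_square h₁ h₄.symm h₂.symm h₃ (by tauto) (by tauto)
  | .cons h₁ (.cons h₂ (.cons h₃ (.cons h₄ (.cons h₅ p)))), hC, hlt =>
    simp at hlt; omega

end Final

/-- Standing hypotheses: `G` and `H` are 3-regular graphs on the same number `n` of vertices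
with the same `(n-2)`-deck, `H` is not isomorphic to `G`, and `g` is the girth of `G`. -/
theorem no_spliced_short_cycles
    {V W : Type*} [Fintype V] [Fintype W] [DecidableEq V] [DecidableEq W]
    (G : SimpleGraph V) (H : SimpleGraph W)
    [DecidableRel G.Adj] [DecidableRel H.Adj]
    (hG : G.IsRegularOfDegree 3) (hH : H.IsRegularOfDegree 3)
    (hcard : Fintype.card V = Fintype.card W)
    (hdeck : SameDeck G H (Fintype.card V - 2))
    (hniso : ¬ Nonempty (G ≃g H))
    (g : ℕ) (hgirth : G.egirth = g)
    :
    ¬ ∃ (v₁ v₂ : V) (C : G.Walk v₁ v₁) (D : G.Walk v₂ v₂) (a b c : V),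
      C.IsCycle ∧ D.IsCycle ∧ C.length ≤ g + 1 ∧ D.length ≤ g + 1 ∧
      {e | e ∈ C.edges} ≠ {e | e ∈ D.edges} ∧ a ≠ c ∧
      s(a, b) ∈ C.edges ∧ s(b, c) ∈ C.edges ∧
      s(a, b) ∈ D.edges ∧ s(b, c) ∈ D.edges := by
  rintro ⟨v₁, v₂, C, D, a, b, c, hC, hD, hCl, hDl, hne, hac, habC, hbcC, habD, hbcD⟩
  let φ := Iso.comap (Fintype.equivOfCardEq hcard) H
  have hcubic : IsCubic (H.comap (Fintype.equivOfCardEq hcard)) := fun v => by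
    rw [← hH.isCubic (φ v), ← Nat.card_coe_set_eq, ← Nat.card_coe_set_eq]
    exact Nat.card_congr (φ.mapNeighborSet v)
  have hpair : DeckPair G (H.comap (Fintype.equivOfCardEq hcard)) :=
    ⟨hG.isCubic, hcubic, hdeck.congr_right φ.symm, fun ⟨ψ⟩ => hniso ⟨ψ.trans φ⟩⟩
  have hg : GirthGE G g := fun u c hc => by
    simpa [hgirth] using egirth_le_length hc
  obtain ⟨u, S, hS, hSl⟩ := exists_egirth_eq_length.2 fun hA : G.IsAcyclic => hA C hC
  replace hSl : S.length = g := by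
    rw [hgirth] at hSl; exact_mod_cast hSl.symm
  obtain ⟨k, rfl⟩ : ∃ k, g = k + 4 :=
    ⟨g - 4, by have := hpair.girth_five u S hS; omega⟩
  have hk : 1 ≤ k := by
    have := hpair.girth_five u S hS; omega
  have hle := hg.le_card hG.isCubic hk hS hSl.le
  have hmate : Mate k G (H.comap (Fintype.equivOfCardEq hcard)) :=
    ⟨hpair, hk, hg, hpair.girthGE hg (by omega), hle⟩
  obtain ⟨p, hp, hbp, hpl, hpe⟩ := hC.exists_isPath_of_mem_edges habC hbcC hac
  obtain ⟨q, hq, hbq, hql, hqe⟩ := hD.exists_isPath_of_mem_edges habD hbcD hac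
  obtain rfl := hmate.isPath_unique_of_adj (C.adj_of_mem_edges habC) (C.adj_of_mem_edges hbcC) hac
    hp hq hbp hbq (by omega) (by omega)
  exact hne (Set.ext fun e => (hpe e).trans (hqe e).symm)
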